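/- arXiv:1901.04835 — 2 statements merged into one kernel-verified Lean document; each statement's English description precedes it below -/
import Mathlib

section
/- Let k > 1 and m > 1 be integers, and let s, t be integers with 0 ≤ s < k and 1 ≤ t < m. Set r = sm + t and assume gcd(r, k) = 1. For an integer N ≥ 0, let p_{m,k,r}(N) denote the number of partitions of N into parts each congruent to 0, r, or −r modulo mk. Then for every integer n, ∑_j (−1)^j · p_{m,k,r}(nk − rs − mk·j(j+1)/2 − j(tk − r)) = 0, where the sum runs over all integers j (positive, negative, and zero) for which the argument nk − rs − mk·j(j+1)/2 − j(tk − r) is nonnegative. -/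
/-- `partitionCount m k r N` is the number of partitions of `N` all of whose parts are
congruent to `0`, `r` or `-r` modulo `m * k` (with `partitionCount m k r 0 = 1`,
counting the empty partition). -/
noncomputable def partitionCount (m k r N : ℕ) : ℕ :=
  Nat.card {p : N.Partition //
    ∀ x ∈ p.parts, (x : ZMod (m * k)) = 0 ∨ (x : ZMod (m * k)) = (r : ZMod (m * k)) ∨
      (x : ZMod (m * k)) = -(r : ZMod (m * k))}

open PowerSeries Filter Topology
open scoped PowerSeries.WithPiTopology

namespace ThetaQuotient

/-- The sign `(-1) ^ j` of an integer `j`, as a power series. -/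
noncomputable def altSign (j : ℤ) : ℤ⟦X⟧ := (-1) ^ j.natAbs

lemma altSign_zero : altSign 0 = 1 := by simp [altSign]

lemma altSign_eq_ite (j : ℤ) : altSign j = if Even j then 1 else -1 := by
  unfold altSign
  split_ifs with h
  · exact (Int.natAbs_even.2 h).neg_one_pow
  · exact (Nat.not_even_iff_odd.1 (Int.natAbs_even.not.2 h)).neg_one_pow

lemma altSign_add_one (j : ℤ) : altSign (j + 1) = -altSign j := by
  simp only [altSign_eq_ite, Int.even_add_one]
  split_ifs <;> simp_all

lemma altSign_neg (j : ℤ) : altSign (-j) = altSign j := by simp [altSign]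

/-- The monomial `X ^ e` for an integer exponent `e`, meaningful for `0 ≤ e`. -/
noncomputable def mono (e : ℤ) : ℤ⟦X⟧ := X ^ e.toNat

lemma mono_zero : mono 0 = 1 := by simp [mono]

lemma mono_ne_zero (e : ℤ) : mono e ≠ 0 := pow_ne_zero _ X_ne_zero

lemma mono_mul {a b : ℤ} (ha : 0 ≤ a) (hb : 0 ≤ b) : mono a * mono b = mono (a + b) := by
  rw [mono, mono, mono, ← pow_add, Int.toNat_add ha hb]

lemma mono_dvd_mono {a b : ℤ} (h : a ≤ b) : mono a ∣ mono b :=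
  pow_dvd_pow _ (Int.toNat_le_toNat h)

lemma coeff_mono {e : ℤ} (he : 0 ≤ e) (d : ℕ) : coeff d (mono e) = if e = d then 1 else 0 := by
  rw [mono, coeff_X_pow]
  congr 1
  apply propext
  omega

/-- A family of power series all but finitely many of which are divisible by any given power
of `X`. -/
def XAdicNull {ι : Type*} (f : ι → ℤ⟦X⟧) : Prop := ∀ d : ℕ, {i | ¬ X ^ d ∣ f i}.Finite

namespace XAdicNull

variable {ι κ : Type*} {f g : ι → ℤ⟦X⟧}

lemma finite_support_coeff (hf : XAdicNull f) (d : ℕ) :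
    (Function.support fun i ↦ coeff d (f i)).Finite :=
  (hf (d + 1)).subset fun _ hi h ↦ hi (X_pow_dvd_iff.1 h d d.lt_succ_self)

lemma summable (hf : XAdicNull f) : Summable f :=
  (WithPiTopology.summable_iff_summable_coeff ℤ).2 fun d ↦
    summable_of_hasFiniteSupport (hf.finite_support_coeff d)

lemma of_dvd (hf : XAdicNull f) (h : ∀ i, f i ∣ g i) : XAdicNull g :=
  fun d ↦ (hf d).subset fun i hi hd ↦ hi (hd.trans (h i))

lemma mul {g : κ → ℤ⟦X⟧} (hf : XAdicNull f) (hg : XAdicNull g) :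
    XAdicNull fun p : ι × κ ↦ f p.1 * g p.2 :=
  fun d ↦ ((hf d).prod (hg d)).subset fun _ hp ↦
    ⟨fun h ↦ hp (h.mul_right _), fun h ↦ hp (h.mul_left _)⟩

lemma mul_left (hf : XAdicNull f) (a : ℤ⟦X⟧) : XAdicNull fun i ↦ a * f i :=
  hf.of_dvd fun _ ↦ dvd_mul_left _ _

lemma coeff_tsum (hf : XAdicNull f) (d : ℕ) :
    coeff d (∑' i, f i) = ∑ᶠ i, coeff d (f i) := by
  have h := (WithPiTopology.hasSum_iff_hasSum_coeff ℤ).1 hf.summable.hasSum d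
  rw [← h.tsum_eq, tsum_eq_finsum (hf.finite_support_coeff d)]

end XAdicNull

lemma xAdicNull_mono_of_finite {ι : Type*} {e : ι → ℤ} (he : ∀ d : ℤ, {i | e i < d}.Finite) :
    XAdicNull fun i ↦ mono (e i) :=
  fun d ↦ (he d).subset fun i hi ↦ by
    by_contra h
    exact hi (pow_dvd_pow _ (by simp only [Set.mem_ofPred_eq] at h; omega))

lemma xAdicNull_mono_of_abs_le {e : ℤ → ℤ} (c : ℤ) (he : ∀ j, |j| ≤ e j + c) :
    XAdicNull fun j ↦ mono (e j) :=
  xAdicNull_mono_of_finite fun d ↦ (Set.finite_Icc (-(d + c)) (d + c)).subset fun j hj ↦ by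
    have := abs_le.1 (he j)
    simp only [Set.mem_ofPred_eq] at hj
    constructor <;> linarith

/-- The triangular number `j (j - 1) / 2`. -/
def tri (j : ℤ) : ℤ := j * (j - 1) / 2

lemma two_mul_tri (j : ℤ) : 2 * tri j = j * (j - 1) :=
  Int.mul_ediv_cancel' (Int.even_mul_pred_self j).two_dvd

lemma tri_add_one (j : ℤ) : tri (j + 1) = tri j + j := by
  have := two_mul_tri j
  have := two_mul_tri (j + 1)
  linarith

lemma tri_neg (j : ℤ) : tri (-j) = tri j + j := by
  have := two_mul_tri j
  have := two_mul_tri (-j)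
  linarith

lemma tri_nonneg (j : ℤ) : 0 ≤ tri j := by
  have h := two_mul_tri j
  rcases le_or_gt j 0 with hj | hj <;> nlinarith

lemma abs_le_tri_add_one (j : ℤ) : |j| ≤ tri j + 1 := by
  have h := two_mul_tri j
  rw [abs_le]
  constructor
  · nlinarith [sq_nonneg (2 * j + 1)]
  · rcases le_or_gt j 1 with hj | hj
    · linarith [tri_nonneg j]
    · rcases (show j = 2 ∨ 3 ≤ j by omega) with rfl | hj <;> nlinarith

/-- The exponent of the `j`-th term of the theta series with base `X ^ M` at `X ^ r`. -/
def thetaExp (M r j : ℤ) : ℤ := M * tri j + r * j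

lemma thetaExp_add_one (M r j : ℤ) : thetaExp M r (j + 1) = thetaExp M r j + M * j + r := by
  rw [thetaExp, thetaExp, tri_add_one]; ring

lemma abs_le_thetaExp {M r : ℤ} (hr : 0 < r) (hM : r < M) (j : ℤ) : |j| ≤ thetaExp M r j := by
  have h := tri_nonneg j
  rcases le_or_gt 0 j with hj | hj
  · rw [abs_of_nonneg hj, thetaExp]; nlinarith
  · have h2 : -j ≤ tri j := by have := two_mul_tri j; nlinarith
    rw [abs_of_neg hj, thetaExp]; nlinarith

lemma thetaExp_nonneg {M r : ℤ} (hr : 0 < r) (hM : r < M) (j : ℤ) : 0 ≤ thetaExp M r j :=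
  (abs_nonneg j).trans (abs_le_thetaExp hr hM j)

/-- The theta series `∑ (-1) ^ j X ^ (M j (j - 1) / 2 + r j)`. -/
noncomputable def theta (M r : ℤ) : ℤ⟦X⟧ := ∑' j : ℤ, altSign j * mono (thetaExp M r j)

lemma xAdicNull_theta {M r : ℤ} (hr : 0 < r) (hM : r < M) :
    XAdicNull fun j ↦ altSign j * mono (thetaExp M r j) :=
  (xAdicNull_mono_of_abs_le 0 fun j ↦ by simpa using abs_le_thetaExp hr hM j).of_dvd
    fun _ ↦ dvd_mul_left _ _

/-- The geometric series `1 / (1 - X ^ w)` for `0 < w`. -/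
noncomputable def geo (w : ℤ) : ℤ⟦X⟧ := ∑' i : ℕ, mono w ^ i

lemma constantCoeff_mono {w : ℤ} (hw : 0 < w) : constantCoeff (mono w) = 0 := by
  rw [← coeff_zero_eq_constantCoeff_apply, coeff_mono hw.le]
  simp [hw.ne']

lemma one_sub_mono_mul_geo {w : ℤ} (hw : 0 < w) : (1 - mono w) * geo w = 1 :=
  WithPiTopology.one_sub_mul_tsum_pow_of_constantCoeff_eq_zero (constantCoeff_mono hw)

/-- The expansion of `X ^ e / (1 - X ^ w)` as a power series, for `w` of either sign. -/
noncomputable def kernel (e w : ℤ) : ℤ⟦X⟧ :=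
  if 0 < w then mono e * geo w else -(mono (e - w) * geo (-w))

/-- The condition on `e` and `w` under which `kernel e w` really is a power series. -/
def Admissible (e w : ℤ) : Prop := (0 < w ∧ 0 ≤ e) ∨ (w < 0 ∧ 0 ≤ e - w)

lemma mono_mul_kernel {f e w : ℤ} (hf : 0 ≤ f) (h : Admissible e w) :
    mono f * kernel e w = kernel (f + e) w := by
  rcases h with ⟨hw, he⟩ | ⟨hw, he⟩
  · rw [kernel, kernel, if_pos hw, if_pos hw, ← mul_assoc, mono_mul hf he]
  · rw [kernel, kernel, if_neg hw.not_gt, if_neg hw.not_gt, mul_neg, ← mul_assoc, mono_mul hf he,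
      add_sub_assoc]

lemma kernel_sub_kernel {e w : ℤ} (he : 0 ≤ e) (hw : w ≠ 0) :
    kernel e w - kernel (e + w) w = mono e := by
  rcases hw.lt_or_gt with hw | hw
  · rw [kernel, kernel, if_neg hw.not_gt, if_neg hw.not_gt, add_sub_cancel_right, sub_eq_add_neg e w,
      ← mono_mul he (neg_nonneg.2 hw.le)]
    linear_combination mono e * one_sub_mono_mul_geo (neg_pos.2 hw)
  · rw [kernel, kernel, if_pos hw, if_pos hw, ← mono_mul he hw.le]
    linear_combination mono e * one_sub_mono_mul_geo hw

lemma mono_dvd_kernel {x e w : ℤ} (hpos : 0 < w → x ≤ e) (hneg : w ≤ 0 → x ≤ e - w) :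
    mono x ∣ kernel e w := by
  unfold kernel
  split_ifs with hw
  · exact (mono_dvd_mono (hpos hw)).mul_right _
  · exact ((mono_dvd_mono (hneg (not_lt.1 hw))).mul_right _).neg_right

lemma add_mul_ne_zero {M u : ℤ} (hu : 0 < u) (huM : u < M) (x : ℤ) : u + M * x ≠ 0 := by
  intro h
  rcases le_or_gt 0 x with hx | hx <;> nlinarith

lemma add_mul_pos_iff {M u : ℤ} (hu : 0 < u) (huM : u < M) (x : ℤ) : 0 < u + M * x ↔ 0 ≤ x := by
  constructor
  · intro h
    by_contra! hx
    nlinarith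
  · intro hx
    nlinarith

lemma admissible_of_nonneg {e w : ℤ} (he : 0 ≤ e) (hw : w ≠ 0) : Admissible e w := by
  rcases hw.lt_or_gt with hw | hw
  · exact Or.inr ⟨hw, by linarith⟩
  · exact Or.inl ⟨hw, he⟩

/-- The coefficient of `a ^ N` in the product of the theta series at `a` and
`∑ a ^ l / (1 - X ^ (u + M l))`. -/
noncomputable def appell (M u N : ℤ) : ℤ⟦X⟧ :=
  ∑' j : ℤ, altSign j * kernel (M * tri j) (u + M * (N - j))

lemma tri_le_mul_tri {M : ℤ} (hM : 0 < M) (j : ℤ) : tri j ≤ M * tri j :=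
  le_mul_of_one_le_left (tri_nonneg j) hM

lemma xAdicNull_appell {M : ℤ} (hM : 0 < M) (w : ℤ → ℤ) :
    XAdicNull fun j ↦ altSign j * kernel (M * tri j) (w j) :=
  (xAdicNull_mono_of_abs_le 1 abs_le_tri_add_one).of_dvd fun j ↦ Dvd.dvd.mul_left
    (mono_dvd_kernel (fun _ ↦ tri_le_mul_tri hM j)
      fun h ↦ (tri_le_mul_tri hM j).trans (by linarith)) _

lemma tsum_altSign_mul_mono_tri (M B : ℤ) :
    ∑' j : ℤ, altSign j * mono (B + M * tri (j + 1)) = 0 := by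
  have h : ∑' j : ℤ, altSign j * mono (B + M * tri (j + 1)) =
      -∑' j : ℤ, altSign j * mono (B + M * tri (j + 1)) := by
    conv_lhs => rw [← ((Equiv.neg ℤ).trans (Equiv.subRight 1)).tsum_eq]
    rw [← tsum_neg]
    refine tsum_congr fun j ↦ ?_
    have h1 : altSign (-j - 1) = -altSign j := by
      rw [← altSign_neg, show -(-j - 1) = j + 1 by ring, altSign_add_one]
    simp only [Equiv.trans_apply, Equiv.neg_apply, Equiv.subRight_apply, h1, sub_add_cancel,
      tri_neg, tri_add_one, neg_mul]
  ext d
  have := congrArg (coeff d) h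
  rw [map_neg] at this
  simpa using self_eq_neg.1 this

lemma mono_mul_appell_add_one {M u B N : ℤ} (hu : 0 < u) (huM : u < M) (hB : 0 ≤ B)
    (hBN : 0 ≤ B + u + M * N) :
    mono B * appell M u (N + 1) = -(mono (B + u + M * N) * appell M u N) := by
  have hM : 0 < M := hu.trans huM
  have hs1 := (xAdicNull_appell hM fun j ↦ u + M * (N + 1 - j)).summable
  have hs2 := (xAdicNull_appell hM fun j ↦ u + M * (N - j)).summable
  have hs3 := (Equiv.addRight (1 : ℤ)).summable_iff.2 hs1
  rw [← add_eq_zero_iff_eq_neg, appell, appell, ← (Equiv.addRight (1 : ℤ)).tsum_eq,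
    ← hs2.tsum_mul_left]
  erw [← hs3.tsum_mul_left]
  rw [← (hs3.mul_left _).tsum_add (hs2.mul_left _), ← neg_eq_zero, ← tsum_neg,
    ← tsum_altSign_mul_mono_tri M B]
  refine tsum_congr fun j ↦ ?_
  have hw := add_mul_ne_zero hu huM (N - j)
  have hT := fun i ↦ mul_nonneg hM.le (tri_nonneg i)
  have h1 := mono_mul_kernel hB (admissible_of_nonneg (hT (j + 1)) hw)
  have h2 := mono_mul_kernel hBN (admissible_of_nonneg (hT j) hw)
  have h3 := kernel_sub_kernel (add_nonneg hB (hT (j + 1))) hw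
  rw [show B + M * tri (j + 1) + (u + M * (N - j)) = B + u + M * N + M * tri j by
    rw [tri_add_one]; ring] at h3
  simp only [Function.comp_apply, Equiv.coe_addRight, altSign_add_one,
    show N + 1 - (j + 1) = N - j by ring]
  linear_combination altSign j * (h1 - h2 + h3)

lemma appell_eq {M u : ℤ} (hu : 0 < u) (huM : u < M) (N : ℤ) :
    appell M u N = altSign N * mono (thetaExp M u N) * appell M u 0 := by
  have step (N : ℤ) : appell M u N = altSign N * mono (thetaExp M u N) * appell M u 0 ↔
      appell M u (N + 1) =
        altSign (N + 1) * mono (thetaExp M u (N + 1)) * appell M u 0 := by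
    have hB : 0 ≤ M * |N| := mul_nonneg (hu.trans huM).le (abs_nonneg N)
    have hBN : 0 ≤ M * |N| + u + M * N := by
      nlinarith [neg_abs_le N]
    have h1 := mono_mul_appell_add_one hu huM hB hBN
    have h2 := mono_mul hBN (thetaExp_nonneg hu huM N)
    have h3 := mono_mul hB (thetaExp_nonneg hu huM (N + 1))
    rw [show M * |N| + u + M * N + thetaExp M u N = M * |N| + thetaExp M u (N + 1) by
      rw [thetaExp_add_one]; ring] at h2
    rw [← mul_right_inj' (mono_ne_zero (M * |N| + u + M * N)),
      ← mul_right_inj' (b := appell M u (N + 1)) (mono_ne_zero (M * |N|)), altSign_add_one]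
    constructor <;> intro h <;>
      linear_combination h1 - h + (altSign N * appell M u 0) * (h3 - h2)
  induction N using Int.induction_on with
  | zero => simp [altSign_zero, thetaExp, tri, mono_zero]
  | succ i ih => exact (step i).1 ih
  | pred i ih => exact (step _).2 (by rwa [sub_add_cancel])

/-- The two-variable series `X ^ M * ∑ X ^ (r l) / (1 - X ^ (u + M l))`, where the sum is over
all integers `l` and the factor `X ^ M` makes all exponents nonnegative. -/
noncomputable def lambert (M r u : ℤ) : ℤ⟦X⟧ := ∑' l : ℤ, kernel (M + r * l) (u + M * l)

/-- The theta series at `X ^ (r + u)`, multiplied by `X ^ M` to make all exponents nonnegative. -/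
noncomputable def shiftedTheta (M r u : ℤ) : ℤ⟦X⟧ :=
  ∑' N : ℤ, altSign N * mono (M + r * N + thetaExp M u N)

section

variable {M r u : ℤ} (hr : 0 < r) (hrM : r < M) (hu : 0 < u) (huM : u < M)
include hr hrM hu huM

lemma abs_le_add_thetaExp (N : ℤ) : |N| ≤ M + r * N + thetaExp M u N := by
  have h := two_mul_tri N
  have h0 := tri_nonneg N
  rw [thetaExp]
  rcases le_or_gt 0 N with hN | hN
  · rw [abs_of_nonneg hN]
    nlinarith
  · rw [abs_of_neg hN]
    have h2 : -N - 1 ≤ tri N + N := by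
      rcases (show N = -1 ∨ N ≤ -2 by omega) with rfl | hN <;> nlinarith
    nlinarith

lemma xAdicNull_shiftedTheta :
    XAdicNull fun N ↦ altSign N * mono (M + r * N + thetaExp M u N) :=
  (xAdicNull_mono_of_abs_le 0 fun j ↦ by
    simpa using abs_le_add_thetaExp hr hrM hu huM j).of_dvd fun _ ↦ dvd_mul_left _ _

lemma admissible_lambert (l : ℤ) : Admissible (M + r * l) (u + M * l) := by
  rcases le_or_gt 0 l with hl | hl
  · exact Or.inl ⟨(add_mul_pos_iff hu huM l).2 hl, by nlinarith⟩
  · exact Or.inr ⟨by nlinarith, by nlinarith⟩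

lemma xAdicNull_lambert : XAdicNull fun l ↦ kernel (M + r * l) (u + M * l) := by
  refine (xAdicNull_mono_of_abs_le (e := fun l ↦ |l|) 0 (by simp)).of_dvd fun l ↦
    mono_dvd_kernel (fun hw ↦ ?_) fun hw ↦ ?_
  · have hl := (add_mul_pos_iff hu huM l).1 hw
    rw [abs_of_nonneg hl]
    nlinarith
  · have hl : l < 0 := by
      by_contra! hl
      exact hw.not_gt ((add_mul_pos_iff hu huM l).2 hl)
    rw [abs_of_neg hl]
    nlinarith

lemma hasSum_theta_mul_kernel (N : ℤ) :
    HasSum (fun j ↦ altSign j * mono (thetaExp M r j) *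
        kernel (M + r * (N - j)) (u + M * (N - j)))
      (appell M u 0 * (altSign N * mono (M + r * N + thetaExp M u N))) := by
  have hM := hr.trans hrM
  have hB : 0 ≤ r * |N| := mul_nonneg hr.le (abs_nonneg N)
  have hBN : 0 ≤ r * |N| + (M + r * N) := by nlinarith [neg_abs_le N]
  have hE := (abs_nonneg N).trans (abs_le_add_thetaExp hr hrM hu huM N)
  have hs : Summable fun j ↦ altSign j * mono (thetaExp M r j) *
      kernel (M + r * (N - j)) (u + M * (N - j)) :=
    ((xAdicNull_theta hr hrM).of_dvd fun j ↦ dvd_mul_right _ _).summable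
  have hs' := (xAdicNull_appell hM fun j ↦ u + M * (N - j)).summable
  suffices h : ∑' j, altSign j * mono (thetaExp M r j) *
      kernel (M + r * (N - j)) (u + M * (N - j)) =
      appell M u 0 * (altSign N * mono (M + r * N + thetaExp M u N)) from h ▸ hs.hasSum
  apply mul_left_cancel₀ (mono_ne_zero (r * |N|))
  have h1 : mono (r * |N|) * ∑' j, altSign j * mono (thetaExp M r j) *
      kernel (M + r * (N - j)) (u + M * (N - j)) =
      mono (r * |N| + (M + r * N)) * appell M u N := by
    rw [appell, ← hs.tsum_mul_left, ← hs'.tsum_mul_left]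
    refine tsum_congr fun j ↦ ?_
    have h2 := mono_mul_kernel (thetaExp_nonneg hr hrM j)
      (admissible_lambert hr hrM hu huM (N - j))
    have h3 := mono_mul hB (thetaExp_nonneg hr hrM j)
    have h4 := mono_mul_kernel (add_nonneg hB (thetaExp_nonneg hr hrM j))
      (admissible_lambert hr hrM hu huM (N - j))
    have h5 := mono_mul_kernel hBN (admissible_of_nonneg
      (mul_nonneg hM.le (tri_nonneg j)) (add_mul_ne_zero hu huM (N - j)))
    rw [show r * |N| + thetaExp M r j + (M + r * (N - j)) =
      r * |N| + (M + r * N) + M * tri j by rw [thetaExp]; ring, ← h5, ← h3] at h4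
    linear_combination altSign j * h4
  rw [h1, appell_eq hu huM N]
  have h6 := mono_mul hBN (thetaExp_nonneg hu huM N)
  have h7 := mono_mul hB hE
  rw [← add_assoc] at h7
  linear_combination altSign N * appell M u 0 * (h6 - h7)

/-- The product of a theta series with a Lambert series is a theta series, up to a factor which
does not depend on `r`. -/
theorem theta_mul_lambert :
    theta M r * lambert M r u = appell M u 0 * shiftedTheta M r u := by
  have hθ := xAdicNull_theta hr hrM
  have hl := xAdicNull_lambert hr hrM hu huM
  have h1 := hθ.summable.hasSum.mul hl.summable.hasSum (hθ.mul hl).summable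
  let e : ℤ × ℤ ≃ ℤ × ℤ :=
    { toFun := fun p ↦ (p.2, p.1 - p.2)
      invFun := fun p ↦ (p.1 + p.2, p.1)
      left_inv := fun p ↦ by simp
      right_inv := fun p ↦ by simp }
  have h2 := (e.hasSum_iff.2 h1).prod_fiberwise (hasSum_theta_mul_kernel hr hrM hu huM)
  exact h2.unique
    ((xAdicNull_shiftedTheta hr hrM hu huM).summable.hasSum.mul_left (appell M u 0))

end

/-- The `i`-th term of the expansion of `kernel e w` into signed monomials. -/
noncomputable def kernelTerm (e w i : ℤ) : ℤ⟦X⟧ :=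
  if 0 < w ∧ 0 ≤ i then mono (e + w * i) else if w < 0 ∧ i < 0 then -mono (e + w * i) else 0

lemma mono_pow {w : ℤ} (hw : 0 ≤ w) (i : ℕ) : mono w ^ i = mono (w * i) := by
  rw [mono, mono, ← pow_mul, Int.toNat_mul hw (Int.natCast_nonneg i), Int.toNat_natCast]

lemma hasSum_geo {w : ℤ} (hw : 0 < w) : HasSum (fun i : ℕ ↦ mono (w * i)) (geo w) := by
  simp only [← mono_pow hw.le]
  exact (WithPiTopology.summable_pow_of_constantCoeff_eq_zero (constantCoeff_mono hw)).hasSum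

lemma hasSum_kernel {e w : ℤ} (h : Admissible e w) :
    HasSum (kernelTerm e w) (kernel e w) := by
  rcases h with ⟨hw, he⟩ | ⟨hw, he⟩
  · have hinj : Function.Injective fun i : ℕ ↦ (i : ℤ) := Nat.cast_injective
    rw [← hinj.hasSum_iff, kernel, if_pos hw]
    · have h : kernelTerm e w ∘ (fun i : ℕ ↦ (i : ℤ)) = fun i : ℕ ↦ mono e * mono (w * i) := by
        funext i
        rw [Function.comp_apply, kernelTerm, if_pos ⟨hw, Int.natCast_nonneg i⟩,
          mono_mul he (by positivity)]
      rw [h]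
      exact (hasSum_geo hw).mul_left (mono e)
    · intro i hi
      have hi' : ¬ 0 ≤ i := fun h ↦ hi ⟨i.toNat, Int.toNat_of_nonneg h⟩
      rw [kernelTerm, if_neg (fun h ↦ hi' h.2), if_neg (fun h ↦ hw.not_gt h.1)]
  · have hinj : Function.Injective fun i : ℕ ↦ (-1 - i : ℤ) := fun a b h ↦ by simpa using h
    rw [← hinj.hasSum_iff, kernel, if_neg hw.not_gt]
    · have h : kernelTerm e w ∘ (fun i : ℕ ↦ (-1 - i : ℤ)) =
          fun i : ℕ ↦ -(mono (e - w) * mono (-w * i)) := by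
        funext i
        rw [Function.comp_apply, kernelTerm, if_neg (fun h ↦ hw.not_gt h.1),
          if_pos ⟨hw, by omega⟩,
          mono_mul he (mul_nonneg (neg_nonneg.2 hw.le) (Int.natCast_nonneg i))]
        congr 2
        ring
      rw [h]
      exact ((hasSum_geo (neg_pos.2 hw)).mul_left (mono (e - w))).neg
    · intro i hi
      have hi' : ¬ i < 0 := fun h ↦ hi ⟨(-1 - i).toNat, by
        change -1 - ((-1 - i).toNat : ℤ) = i
        omega⟩
      rw [kernelTerm, if_neg (fun h ↦ hw.not_gt h.1), if_neg (fun h ↦ hi' h.2)]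

lemma coeff_kernelTerm {e w : ℤ} (h : Admissible e w) (i : ℤ) (d : ℕ) :
    coeff d (kernelTerm e w i) = if e + w * i = d then
      (if 0 < w ∧ 0 ≤ i then 1 else if w < 0 ∧ i < 0 then -1 else 0) else 0 := by
  rw [kernelTerm]
  split_ifs with h1 h2 h3 h4 h5
  · rw [coeff_mono (by rw [h2]; positivity), if_pos h2]
  · have he : 0 ≤ e := by rcases h with h | h <;> omega
    rw [coeff_mono (add_nonneg he (mul_nonneg h1.1.le h1.2)), if_neg h2]
  · rw [map_neg, coeff_mono (by rw [h4]; positivity), if_pos h4]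
  · have he : 0 ≤ e - w := by rcases h with h | h <;> omega
    rw [map_neg, coeff_mono (by nlinarith), if_neg h4, neg_zero]
  · simp
  · simp

lemma coeff_kernel_eq_zero {e w k : ℤ} (h : Admissible e w) (he : k ∣ e) (hw : k ∣ w) {d : ℕ}
    (hd : ¬ k ∣ d) : coeff d (kernel e w) = 0 := by
  have h1 := (WithPiTopology.hasSum_iff_hasSum_coeff ℤ).1 (hasSum_kernel h) d
  rw [← h1.tsum_eq]
  convert tsum_zero with i
  rw [coeff_kernelTerm h, if_neg]
  exact fun h2 ↦ hd (h2 ▸ dvd_add he (hw.mul_right i))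

section

variable {M r u : ℤ} (hr : 0 < r) (hrM : r < M) (hu : 0 < u) (huM : u < M)
include hu huM

lemma coeff_appell_eq_zero {k : ℤ} (hM : k ∣ M) (hku : k ∣ u) {d : ℕ} (hd : ¬ k ∣ d) :
    coeff d (appell M u 0) = 0 := by
  have hM0 := hu.trans huM
  rw [appell, (xAdicNull_appell hM0 fun j ↦ u + M * (0 - j)).coeff_tsum]
  convert finsum_zero with j
  have h := coeff_kernel_eq_zero (admissible_of_nonneg (mul_nonneg hM0.le (tri_nonneg j))
    (add_mul_ne_zero hu huM (0 - j))) (hM.mul_right _) (dvd_add hku (hM.mul_right _)) hd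
  rw [altSign_eq_ite]
  split_ifs
  · rw [one_mul, h]
  · rw [neg_one_mul, map_neg, h, neg_zero]

lemma constantCoeff_appell : constantCoeff (appell M u 0) = 1 := by
  have hM0 := hu.trans huM
  rw [← coeff_zero_eq_constantCoeff_apply, appell,
    (xAdicNull_appell hM0 fun j ↦ u + M * (0 - j)).coeff_tsum, finsum_eq_single _ 0]
  · have h := congrArg constantCoeff (one_sub_mono_mul_geo hu)
    rw [map_mul, map_sub, constantCoeff_mono hu] at h
    simpa [altSign_zero, tri, kernel, hu, mono_zero] using h
  · intro j hj
    have h : mono 1 ∣ kernel (M * tri j) (u + M * (0 - j)) := by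
      have h2 := two_mul_tri j
      have h3 := tri_nonneg j
      refine mono_dvd_kernel (fun hw ↦ ?_) fun hw ↦ ?_
      · have hj' : j < 0 := by
          have := (add_mul_pos_iff hu huM _).1 hw
          omega
        have : 1 ≤ tri j := by nlinarith
        nlinarith
      · have := add_mul_ne_zero hu huM (0 - j)
        have := mul_nonneg hM0.le h3
        omega
    have h' : X ∣ altSign j * kernel (M * tri j) (u + M * (0 - j)) := by
      simpa [mono] using h.mul_left (altSign j)
    simpa using X_dvd_iff.1 h'

include hr hrM

lemma abs_add_abs_le {l i : ℤ} (h : 0 ≤ l ∧ 0 ≤ i ∨ l < 0 ∧ i < 0) :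
    |l| + |i| ≤ M + r * l + (u + M * l) * i := by
  rcases h with ⟨hl, hi⟩ | ⟨hl, hi⟩
  · rw [abs_of_nonneg hl, abs_of_nonneg hi]
    have := mul_nonneg hl hi
    nlinarith
  · rw [abs_of_neg hl, abs_of_neg hi]
    have : 0 ≤ (-l - 1) * (-i - 1) := mul_nonneg (by omega) (by omega)
    nlinarith

lemma xAdicNull_kernelTerm :
    XAdicNull fun p : ℤ × ℤ ↦ kernelTerm (M + r * p.1) (u + M * p.1) p.2 := by
  refine XAdicNull.of_dvd (f := fun p : ℤ × ℤ ↦ mono (|p.1| + |p.2|))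
    (xAdicNull_mono_of_finite fun d ↦ ?_) fun p ↦ ?_
  · refine ((Set.finite_Icc (-d) d).prod (Set.finite_Icc (-d) d)).subset fun p hp ↦ ?_
    simp only [Set.mem_ofPred_eq] at hp
    have h1 := abs_nonneg p.1
    have h2 := abs_nonneg p.2
    exact ⟨abs_le.1 (by linarith), abs_le.1 (by linarith)⟩
  · simp only [kernelTerm, add_mul_pos_iff hu huM]
    have hneg : u + M * p.1 < 0 → p.1 < 0 := fun h ↦ by
      by_contra! h'
      exact h.not_gt ((add_mul_pos_iff hu huM _).2 h')
    split_ifs with h1 h2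
    · exact mono_dvd_mono (abs_add_abs_le hr hrM hu huM (Or.inl h1))
    · exact (mono_dvd_mono (abs_add_abs_le hr hrM hu huM (Or.inr ⟨hneg h2.1, h2.2⟩))).neg_right
    · exact dvd_zero _

lemma coeff_lambert (d : ℕ) : coeff d (lambert M r u) =
    ∑' p : ℤ × ℤ, coeff d (kernelTerm (M + r * p.1) (u + M * p.1) p.2) := by
  have h := (xAdicNull_kernelTerm hr hrM hu huM).summable.hasSum
  have h2 : HasSum (fun l ↦ kernel (M + r * l) (u + M * l)) _ :=
    h.prod_fiberwise fun l ↦ hasSum_kernel (admissible_lambert hr hrM hu huM l)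
  rw [lambert, h2.tsum_eq]
  exact (((WithPiTopology.hasSum_iff_hasSum_coeff ℤ).1 h) d).tsum_eq.symm

end

/-- The coefficients of the Lambert series vanish on one residue class modulo `k`. -/
lemma coeff_lambert_eq_zero {k m s t : ℤ} (hk : 0 < k) (hs0 : 0 ≤ s) (hs : s < k)
    (ht1 : 1 ≤ t) (ht2 : t < m) (hgcd : IsCoprime (s * m + t) k) {d : ℕ}
    (hd : k ∣ d + (s * m + t) * (s + 1)) :
    coeff d (lambert (m * k) (s * m + t) ((m - t) * k)) = 0 := by
  obtain ⟨r, hr⟩ : ∃ r, r = s * m + t := ⟨_, rfl⟩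
  obtain ⟨M, hM⟩ : ∃ M, M = m * k := ⟨_, rfl⟩
  obtain ⟨u, hu⟩ : ∃ u, u = (m - t) * k := ⟨_, rfl⟩
  rw [← hr] at hgcd hd
  rw [← hM, ← hr, ← hu]
  have hr0 : 0 < r := by nlinarith
  have hrM : r < M := by nlinarith
  have hu0 : 0 < u := by nlinarith
  have huM : u < M := by nlinarith
  have hadm := admissible_lambert hr0 hrM hu0 huM
  rw [coeff_lambert hr0 hrM hu0 huM]
  simp only [coeff_kernelTerm (hadm _)]
  let φ : ℤ × ℤ → ℤ × ℤ := fun p ↦ (k * p.1 - s - 1, p.2)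
  have hφ : Function.Injective φ := fun p q h ↦ by
    simp only [φ, Prod.mk.injEq] at h
    exact Prod.ext (mul_left_cancel₀ hk.ne' (by linarith)) h.2
  rw [← hφ.tsum_eq]
  · rw [← self_eq_neg, ← tsum_neg]
    let e : ℤ × ℤ ≃ ℤ × ℤ := (Equiv.prodComm ℤ ℤ).trans ((Equiv.neg ℤ).prodCongr (Equiv.neg ℤ))
    conv_lhs => rw [← e.tsum_eq]
    refine tsum_congr fun ⟨l, i⟩ ↦ ?_
    have hw (l : ℤ) : u + M * (k * l - s - 1) = k * (m * k * l - r) := by rw [hu, hM, hr]; ring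
    have hpos (l : ℤ) : 0 < u + M * (k * l - s - 1) ↔ 0 < l := by
      rw [add_mul_pos_iff hu0 huM]
      constructor <;> intro h <;> nlinarith
    have hneg (l : ℤ) : u + M * (k * l - s - 1) < 0 ↔ l ≤ 0 := by
      rw [← not_iff_not, not_lt, not_le, ← hpos]
      exact ⟨fun h ↦ h.lt_of_ne' (add_mul_ne_zero hu0 huM _), le_of_lt⟩
    have hexp : M + r * (k * (-i) - s - 1) + (u + M * (k * (-i) - s - 1)) * (-l) =
        M + r * (k * l - s - 1) + (u + M * (k * l - s - 1)) * i := by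
      rw [hw, hw]; ring
    simp only [φ, e, Equiv.trans_apply, Equiv.prodComm_apply, Prod.swap_prod_mk,
      Equiv.prodCongr_apply, Prod.map_apply, Equiv.neg_apply, hexp, hpos, hneg]
    split_ifs <;> omega
  · rintro ⟨l, i⟩ h
    have h1 : M + r * l + (u + M * l) * i = d := by
      by_contra h1
      exact h (if_neg h1)
    have h2 : k ∣ r * (l + s + 1) := by
      have : r * (l + s + 1) = d + r * (s + 1) - k * (m + (m - t + m * l) * i) := by
        rw [← h1, hu, hM]; ring
      rw [this]
      exact dvd_sub hd (dvd_mul_right _ _)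
    obtain ⟨c, hc⟩ := hgcd.symm.dvd_of_dvd_mul_left h2
    exact ⟨(c, i), by simp only [φ, ← hc]; congr 1; ring⟩

/-- The finite product `∏ (1 - X ^ (M i))` over `1 ≤ i ≤ n`. -/
noncomputable def qFactorial (M : ℤ) (n : ℕ) : ℤ⟦X⟧ :=
  ∏ i ∈ Finset.range n, (1 - mono (M * (i + 1)))

/-- The inverse of `qFactorial M e`, extended by zero to negative `e`. -/
noncomputable def qFactorialInv (M e : ℤ) : ℤ⟦X⟧ :=
  if e < 0 then 0 else ∏ i ∈ Finset.range e.toNat, geo (M * (i + 1))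

/-- The central `q`-binomial coefficient `2 n` choose `n + j`, with `q = X ^ M`. -/
noncomputable def qCentralBinom (M : ℤ) (n : ℕ) (j : ℤ) : ℤ⟦X⟧ :=
  qFactorial M (2 * n) * qFactorialInv M (n + j) * qFactorialInv M (n - j)

/-- The finite product `∏ (1 - X ^ (r + M i)) (1 - X ^ (M (i + 1) - r))` over `i < n`. -/
noncomputable def thetaProd (M r : ℤ) (n : ℕ) : ℤ⟦X⟧ :=
  ∏ i ∈ Finset.range n, ((1 - mono (r + M * i)) * (1 - mono (M * (i + 1) - r)))

lemma qFactorialInv_of_neg {M e : ℤ} (he : e < 0) : qFactorialInv M e = 0 := if_pos he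

lemma qCentralBinom_of_lt {M : ℤ} {n : ℕ} {j : ℤ} (h : (n : ℤ) < |j|) :
    qCentralBinom M n j = 0 := by
  rcases lt_abs.1 h with h | h
  · rw [qCentralBinom, qFactorialInv_of_neg (e := n - j) (by omega), mul_zero]
  · rw [qCentralBinom, qFactorialInv_of_neg (e := n + j) (by omega), mul_zero, zero_mul]

section

variable {M : ℤ} (hM : 0 < M)
include hM

lemma qFactorial_mul_qFactorialInv (n : ℕ) : qFactorial M n * qFactorialInv M n = 1 := by
  rw [qFactorial, qFactorialInv, if_neg (by omega), Int.toNat_natCast, ← Finset.prod_mul_distrib]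
  exact Finset.prod_eq_one fun i _ ↦ one_sub_mono_mul_geo (by positivity)

lemma qFactorialInv_sub_one {e : ℤ} (he : 0 ≤ e) :
    qFactorialInv M (e - 1) = (1 - mono (M * e)) * qFactorialInv M e := by
  obtain ⟨n, rfl⟩ := Int.eq_ofNat_of_zero_le he
  rcases n with _ | n
  · rw [qFactorialInv_of_neg (by simp)]
    simp [mono_zero]
  · have h : (0 : ℤ) < M * (n + 1) := by positivity
    rw [qFactorialInv, qFactorialInv, if_neg (by omega), if_neg (by omega),
      show (((n + 1 : ℕ) : ℤ) - 1).toNat = n by omega, Int.toNat_natCast, Finset.prod_range_succ]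
    push_cast
    linear_combination -(∏ i ∈ Finset.range n, geo (M * (i + 1))) * one_sub_mono_mul_geo h

lemma mono_mul_qFactorialInv {a b : ℤ} (ha : 0 ≤ a) (hb : 0 ≤ b) (hab : 1 ≤ a + b) :
    mono (M * b) * qFactorialInv M (a - 2) =
      (mono (M * b) - mono (M * (a + b - 1))) * (1 - mono (M * a)) * qFactorialInv M a := by
  rcases ha.eq_or_lt with rfl | ha
  · rw [qFactorialInv_of_neg (by norm_num)]
    simp [mono_zero]
  · have h1 := qFactorialInv_sub_one hM ha.le
    have h2 := qFactorialInv_sub_one hM (e := a - 1) (by omega)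
    have h3 := mono_mul (mul_nonneg hM.le hb) (mul_nonneg hM.le (show 0 ≤ a - 1 by omega))
    rw [show M * b + M * (a - 1) = M * (a + b - 1) by ring] at h3
    rw [show a - 1 - 1 = a - 2 by ring] at h2
    rw [h2, h1, ← h3]
    ring

lemma qCentralBinom_succ {n : ℕ} {j : ℤ} (h1 : -(n + 1 : ℤ) ≤ j) (h2 : j ≤ n + 1) :
    qCentralBinom M (n + 1) j = (1 + mono (M * (2 * n + 1))) * qCentralBinom M n j +
      mono (M * (n + 1 - j)) * qCentralBinom M n (j - 1) +
      mono (M * (n + 1 + j)) * qCentralBinom M n (j + 1) := by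
  have ha : 0 ≤ n + 1 + j := by omega
  have hb : 0 ≤ n + 1 - j := by omega
  have e1 := qFactorialInv_sub_one hM ha
  have e2 := qFactorialInv_sub_one hM hb
  have e3 := mono_mul_qFactorialInv hM ha hb (by omega)
  have e4 := mono_mul_qFactorialInv hM hb ha (by omega)
  have e5 := mono_mul (mul_nonneg hM.le ha) (mul_nonneg hM.le hb)
  have e6 : qFactorial M (2 * (n + 1)) = qFactorial M (2 * n) *
      (1 - mono (M * (2 * n + 1))) * (1 - mono (M * (n + 1 + j) + M * (n + 1 - j))) := by
    rw [show 2 * (n + 1) = 2 * n + 1 + 1 by ring, qFactorial, Finset.prod_range_succ,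
      Finset.prod_range_succ, qFactorial]
    congr 3
    push_cast
    ring
  rw [show (n : ℤ) + 1 + j + (n + 1 - j) - 1 = 2 * n + 1 by ring] at e3
  rw [show (n : ℤ) + 1 - j + (n + 1 + j) - 1 = 2 * n + 1 by ring] at e4
  simp only [qCentralBinom, e6, ← e5, Nat.cast_add, Nat.cast_one]
  rw [show (n : ℤ) + j = n + 1 + j - 1 by ring, show (n : ℤ) - j = n + 1 - j - 1 by ring, e1, e2,
    show (n : ℤ) + (j - 1) = n + 1 + j - 2 by ring, show (n : ℤ) - (j - 1) = n + 1 - j by ring,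
    show (n : ℤ) + (j + 1) = n + 1 + j by ring, show (n : ℤ) - (j + 1) = n + 1 - j - 2 by ring]
  linear_combination -qFactorial M (2 * n) * qFactorialInv M (n + 1 - j) * e3 -
    qFactorial M (2 * n) * qFactorialInv M (n + 1 + j) * e4

lemma mono_dvd_qFactorial_sub {e n : ℕ} (h : e ≤ n) :
    mono (e + 1) ∣ qFactorial M n - qFactorial M e := by
  induction n, h using Nat.le_induction with
  | base => simp
  | succ n hn ih =>
    have h1 : mono (e + 1) ∣ mono (M * (n + 1)) := mono_dvd_mono (by
      have : (e : ℤ) ≤ n := by exact_mod_cast hn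
      nlinarith)
    rw [show qFactorial M (n + 1) = qFactorial M n * (1 - mono (M * (n + 1))) by
      rw [qFactorial, Finset.prod_range_succ, qFactorial],
      show qFactorial M n * (1 - mono (M * (n + 1))) - qFactorial M e =
        qFactorial M n - qFactorial M e - qFactorial M n * mono (M * (n + 1)) by ring]
    exact dvd_sub ih (h1.mul_left _)

lemma mono_dvd_qFactorial_mul_qCentralBinom_sub_one {n : ℕ} {j : ℤ} (hj : |j| ≤ n) :
    mono (n - |j| + 1) ∣ qFactorial M n * qCentralBinom M n j - 1 := by
  obtain ⟨e, he⟩ := Int.eq_ofNat_of_zero_le (sub_nonneg.2 hj)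
  obtain ⟨hj1, hj2⟩ := abs_le.1 hj
  obtain ⟨a, ha⟩ := Int.eq_ofNat_of_zero_le (show 0 ≤ n + j by omega)
  obtain ⟨b, hb⟩ := Int.eq_ofNat_of_zero_le (show 0 ≤ n - j by omega)
  have h1 := le_abs_self j
  have h2 := neg_abs_le j
  have h3 := abs_nonneg j
  have hn := mono_dvd_qFactorial_sub hM (show e ≤ n by omega)
  have hn2 := mono_dvd_qFactorial_sub hM (show e ≤ 2 * n by omega)
  have hea := mono_dvd_qFactorial_sub hM (show e ≤ a by omega)
  have heb := mono_dvd_qFactorial_sub hM (show e ≤ b by omega)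
  have hia := qFactorial_mul_qFactorialInv hM a
  have hib := qFactorial_mul_qFactorialInv hM b
  rw [he, qCentralBinom, ha, hb]
  have key : qFactorial M n * (qFactorial M (2 * n) * qFactorialInv M a * qFactorialInv M b) - 1 =
      ((qFactorial M n - qFactorial M e) * qFactorial M (2 * n) +
        qFactorial M e * (qFactorial M (2 * n) - qFactorial M e) -
        (qFactorial M a - qFactorial M e) * qFactorial M b -
        qFactorial M e * (qFactorial M b - qFactorial M e)) *
        (qFactorialInv M a * qFactorialInv M b) := by
    linear_combination qFactorial M b * qFactorialInv M b * hia + hib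
  exact key ▸ (dvd_sub (dvd_sub (dvd_add (hn.mul_right _) (hn2.mul_left _)) (hea.mul_right _))
    (heb.mul_left _)).mul_right _

end

section

variable {M r : ℤ} (hr : 0 < r) (hrM : r < M)
include hr hrM

/-- The finite form of the Jacobi triple product identity. -/
lemma thetaProd_eq_tsum (n : ℕ) : thetaProd M r n =
    ∑' j : ℤ, altSign j * mono (thetaExp M r j) * qCentralBinom M n j := by
  have hM := hr.trans hrM
  induction n with
  | zero =>
    rw [tsum_eq_single 0]
    · simp [thetaProd, altSign_zero, thetaExp, tri, mono_zero, qCentralBinom, qFactorial,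
        qFactorialInv]
    · intro j hj
      rw [qCentralBinom_of_lt (by simpa using hj), mul_zero]
  | succ n ih =>
    have hs : Summable fun j ↦ altSign j * mono (thetaExp M r j) * qCentralBinom M n j :=
      ((xAdicNull_theta hr hrM).of_dvd fun j ↦ dvd_mul_right _ _).summable
    have hn : (0 : ℤ) ≤ M * n := by positivity
    have hx := mono_mul (show 0 ≤ r + M * n by linarith) (show 0 ≤ M * (n + 1) - r by linarith)
    have hsub := (Equiv.subRight (1 : ℤ)).summable_iff.2 (hs.mul_left (mono (r + M * n)))
    have hadd := (Equiv.addRight (1 : ℤ)).summable_iff.2 (hs.mul_left (mono (M * (n + 1) - r)))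
    rw [show r + M * n + (M * (n + 1) - r) = M * (2 * n + 1) by ring] at hx
    rw [show thetaProd M r (n + 1) = thetaProd M r n *
      ((1 - mono (r + M * n)) * (1 - mono (M * (n + 1) - r))) by
        rw [thetaProd, Finset.prod_range_succ, thetaProd],
      show (1 - mono (r + M * n)) * (1 - mono (M * (n + 1) - r)) =
        (1 + mono (M * (2 * n + 1))) - mono (r + M * n) - mono (M * (n + 1) - r) by
          rw [← hx]; ring,
      mul_sub, mul_sub, mul_comm _ (1 + _), mul_comm _ (mono _), mul_comm _ (mono _), ih,
      ← hs.tsum_mul_left, ← hs.tsum_mul_left, ← hs.tsum_mul_left,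
      ← (Equiv.subRight (1 : ℤ)).tsum_eq (fun j ↦ mono (r + M * n) * _),
      ← (Equiv.addRight (1 : ℤ)).tsum_eq (fun j ↦ mono (M * (n + 1) - r) * _)]
    erw [← (hs.mul_left _).tsum_sub hsub, ← ((hs.mul_left _).sub hsub).tsum_sub hadd]
    refine tsum_congr fun j ↦ ?_
    simp only [Function.comp_apply, Equiv.coe_addRight, Equiv.subRight_apply]
    by_cases hj : |j| ≤ n + 1
    · obtain ⟨hj1, hj2⟩ := abs_le.1 hj
      have hsgn : altSign j = -altSign (j - 1) := by rw [← altSign_add_one, sub_add_cancel]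
      have h1 := thetaExp_add_one M r (j - 1)
      rw [sub_add_cancel] at h1
      have h2 := thetaExp_add_one M r j
      have h3 := mono_mul (show 0 ≤ r + M * n by linarith) (thetaExp_nonneg hr hrM (j - 1))
      have h4 := mono_mul (show 0 ≤ M * (n + 1 - j) by nlinarith) (thetaExp_nonneg hr hrM j)
      have h5 := mono_mul (show 0 ≤ M * (n + 1) - r by linarith) (thetaExp_nonneg hr hrM (j + 1))
      have h6 := mono_mul (show 0 ≤ M * (n + 1 + j) by nlinarith) (thetaExp_nonneg hr hrM j)
      rw [show M * (n + 1 - j) + thetaExp M r j = r + M * n + thetaExp M r (j - 1) by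
        rw [h1]; ring, ← h3] at h4
      rw [show M * (n + 1 + j) + thetaExp M r j = M * (n + 1) - r + thetaExp M r (j + 1) by
        rw [h2]; ring, ← h5] at h6
      rw [qCentralBinom_succ hM hj1 hj2, altSign_add_one, hsgn]
      linear_combination altSign (j - 1) * qCentralBinom M n (j - 1) * h4 +
        altSign (j - 1) * qCentralBinom M n (j + 1) * h6
    · have hj' : (n : ℤ) + 1 < |j| := not_le.1 hj
      have h1 : (n : ℤ) < |j - 1| := by
        have := abs_sub_abs_le_abs_sub j 1
        simp only [abs_one] at this
        linarith
      have h2 : (n : ℤ) < |j + 1| := by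
        have := abs_sub_abs_le_abs_sub j (-1)
        simp only [abs_neg, abs_one, sub_neg_eq_add] at this
        linarith
      rw [qCentralBinom_of_lt h1, qCentralBinom_of_lt h2,
        qCentralBinom_of_lt (n := n) (j := j) (by linarith),
        qCentralBinom_of_lt (n := n + 1) (j := j) (by push_cast; linarith)]
      ring

lemma X_pow_dvd_qFactorial_mul_thetaProd_sub (n : ℕ) :
    X ^ (n + 1) ∣ qFactorial M n * thetaProd M r n - theta M r := by
  have hM := hr.trans hrM
  have hs : XAdicNull fun j ↦ altSign j * mono (thetaExp M r j) * qCentralBinom M n j :=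
    (xAdicNull_theta hr hrM).of_dvd fun j ↦ dvd_mul_right _ _
  have hθ := xAdicNull_theta hr hrM
  have hterm (j : ℤ) : X ^ (n + 1) ∣ qFactorial M n * (altSign j * mono (thetaExp M r j) *
      qCentralBinom M n j) - altSign j * mono (thetaExp M r j) := by
    have hX : (X : ℤ⟦X⟧) ^ (n + 1) = mono (n + 1) := by
      rw [mono]
      congr 1
    have hE := abs_le_thetaExp hr hrM j
    rw [hX, show qFactorial M n * (altSign j * mono (thetaExp M r j) * qCentralBinom M n j) -
      altSign j * mono (thetaExp M r j) =
      altSign j * (mono (thetaExp M r j) * (qFactorial M n * qCentralBinom M n j - 1)) by ring]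
    refine Dvd.dvd.mul_left ?_ _
    by_cases hj : |j| ≤ n
    · have h := mul_dvd_mul (mono_dvd_mono hE)
        (mono_dvd_qFactorial_mul_qCentralBinom_sub_one hM hj)
      rwa [mono_mul (abs_nonneg j) (by linarith),
        show |j| + (n - |j| + 1) = (n : ℤ) + 1 by ring] at h
    · exact (mono_dvd_mono (by omega)).mul_right _
  rw [X_pow_dvd_iff]
  intro d hd
  rw [thetaProd_eq_tsum hr hrM, theta, ← hs.summable.tsum_mul_left,
    ← (hs.mul_left _).summable.tsum_sub hθ.summable,
    ((hs.mul_left _).summable.sub hθ.summable).map_tsum _ (WithPiTopology.continuous_coeff ℤ d)]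
  convert tsum_zero with j
  exact X_pow_dvd_iff.1 (hterm j) d hd

/-- The Jacobi triple product identity. -/
theorem tendsto_qFactorial_mul_thetaProd :
    Tendsto (fun n ↦ qFactorial M n * thetaProd M r n) atTop (𝓝 (theta M r)) := by
  rw [WithPiTopology.tendsto_iff_coeff_tendsto]
  refine fun d ↦ tendsto_atTop_of_eventually_const (i₀ := d) fun n hn ↦ ?_
  rw [← sub_eq_zero, ← map_sub]
  exact X_pow_dvd_iff.1 (X_pow_dvd_qFactorial_mul_thetaProd_sub hr hrM n) d (by omega)

end

/-- Being congruent to `0`, `r` or `-r` modulo `M`. -/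
def IsAllowedPart (M r x : ℕ) : Prop :=
  (x : ZMod M) = 0 ∨ (x : ZMod M) = (r : ZMod M) ∨ (x : ZMod M) = -(r : ZMod M)

lemma isAllowedPart_iff {M r : ℕ} (hr : 0 < r) (hrM : r < M) (n : ℕ) {x : ℕ} (hx : x < M) :
    IsAllowedPart M r (n * M + x + 1) ↔ x = M - 1 ∨ x = r - 1 ∨ x = M - r - 1 := by
  have h0 : ((n * M + x + 1 : ℕ) : ZMod M) = ((x + 1 : ℕ) : ZMod M) := by simp
  have hneg : -(r : ZMod M) = ((M - r : ℕ) : ZMod M) := by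
    rw [Nat.cast_sub hrM.le]
    simp
  rw [IsAllowedPart, h0, hneg, ← Nat.cast_zero]
  simp only [ZMod.natCast_eq_natCast_iff', Nat.zero_mod]
  rw [Nat.mod_eq_of_lt hrM, Nat.mod_eq_of_lt (show M - r < M by omega)]
  rcases (show x + 1 = M ∨ x + 1 < M by omega) with h | h
  · rw [h, Nat.mod_self]
    omega
  · rw [Nat.mod_eq_of_lt h]
    omega

open Classical in
lemma prod_range_allowed {M r : ℕ} (hr : 0 < r) (hrM : r < M) (h2r : 2 * r ≠ M) (n : ℕ) :
    ∏ i ∈ Finset.range (n * M), (if IsAllowedPart M r (i + 1) then 1 - X ^ (i + 1) else 1) =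
      qFactorial M n * thetaProd M r n := by
  induction n with
  | zero => simp [qFactorial, thetaProd]
  | succ n ih =>
    have hblock : ∏ x ∈ Finset.range M, (if IsAllowedPart M r (n * M + x + 1) then
        (1 : ℤ⟦X⟧) - X ^ (n * M + x + 1) else 1) =
        ∏ x ∈ ({M - 1, r - 1, M - r - 1} : Finset ℕ), (1 - X ^ (n * M + x + 1)) := by
      rw [← Finset.prod_filter]
      refine Finset.prod_congr ?_ fun _ _ ↦ rfl
      ext x
      simp only [Finset.mem_filter, Finset.mem_range, Finset.mem_insert, Finset.mem_singleton]
      constructor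
      · rintro ⟨hx, h⟩
        exact (isAllowedPart_iff hr hrM n hx).1 h
      · intro h
        have hx : x < M := by omega
        exact ⟨hx, (isAllowedPart_iff hr hrM n hx).2 h⟩
    have e1 : (X : ℤ⟦X⟧) ^ (n * M + (M - 1) + 1) = mono (M * (n + 1)) := by
      rw [mono]
      congr 1
      zify [show 1 ≤ M by omega]
      rw [Int.toNat_of_nonneg (by positivity)]
      ring
    have e2 : (X : ℤ⟦X⟧) ^ (n * M + (r - 1) + 1) = mono (r + M * n) := by
      rw [mono]
      congr 1
      zify [show 1 ≤ r by omega]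
      rw [Int.toNat_of_nonneg (by positivity)]
      ring
    have e3 : (X : ℤ⟦X⟧) ^ (n * M + (M - r - 1) + 1) = mono (M * (n + 1) - r) := by
      have h : (0 : ℤ) ≤ M * n := by positivity
      rw [mono]
      congr 1
      zify [show 1 ≤ M - r by omega, hrM.le]
      rw [Int.toNat_of_nonneg (by linarith)]
      ring
    rw [show (n + 1) * M = n * M + M by ring, Finset.prod_range_add, ih, hblock,
      Finset.prod_insert (by simp; omega), Finset.prod_insert (by simp; omega),
      Finset.prod_singleton, e1, e2, e3, qFactorial, qFactorial, thetaProd, thetaProd,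
      Finset.prod_range_succ, Finset.prod_range_succ]
    ring

open Classical in
/-- The generating function of the partitions into allowed parts is the inverse of a theta
series. -/
theorem mk_partitionCount_mul_theta {m k r : ℕ} (hr : 0 < r) (hrM : r < m * k)
    (h2r : 2 * r ≠ m * k) :
    (PowerSeries.mk fun N ↦ (partitionCount m k r N : ℤ)) * theta ((m * k : ℕ) : ℤ) r = 1 := by
  have hcard (N : ℕ) : partitionCount m k r N =
      (Nat.Partition.restricted N (IsAllowedPart (m * k) r)).card := by
    rw [partitionCount, Nat.card_eq_fintype_card, Fintype.card_subtype, Nat.Partition.restricted]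
    congr 1
    ext p
    rw [Finset.mem_filter, Finset.mem_filter]
    rfl
  have hP := (Nat.Partition.hasProd_powerSeriesMk_card_restricted ℤ
    (IsAllowedPart (m * k) r)).tendsto_prod_nat
  simp only [← hcard] at hP
  have hM : 0 < m * k := by omega
  have hP' := hP.comp (tendsto_id.atTop_mul_const' hM)
  have hθ := tendsto_qFactorial_mul_thetaProd (M := ((m * k : ℕ) : ℤ)) (r := r)
    (by exact_mod_cast hr) (by exact_mod_cast hrM)
  refine tendsto_nhds_unique (hP'.mul hθ) (tendsto_const_nhds.congr fun n ↦ ?_)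
  rw [← prod_range_allowed hr hrM h2r, Function.comp_apply, id, ← Finset.prod_mul_distrib]
  refine (Finset.prod_eq_one fun i _ ↦ ?_).symm
  split_ifs
  · have h := WithPiTopology.one_sub_mul_tsum_pow_of_constantCoeff_eq_zero
      (f := (X : ℤ⟦X⟧) ^ (i + 1)) (by simp)
    simp only [← pow_mul] at h
    rw [mul_comm, h]
  · exact mul_one 1

lemma coeff_eq_zero_of_mul_eq {F c L : ℤ⟦X⟧} (h : F * c = L) (h0 : constantCoeff c = 1) {k a : ℤ}
    (hc : ∀ d : ℕ, ¬ k ∣ d → coeff d c = 0) (hL : ∀ d : ℕ, k ∣ d + a → coeff d L = 0) (d : ℕ)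
    (hd : k ∣ d + a) : coeff d F = 0 := by
  induction d using Nat.strong_induction_on with
  | _ d ih =>
    have h1 := hL d hd
    rw [← h, coeff_mul, Finset.sum_eq_single (d, 0)] at h1
    · simpa [h0] using h1
    · rintro ⟨i, j⟩ hij hne
      rw [Finset.HasAntidiagonal.mem_antidiagonal] at hij
      simp only at hij ⊢
      by_cases hj : k ∣ j
      · have hlt : i < d := by
          by_contra! hge
          exact hne (Prod.ext (by simp; omega) (by simp; omega))
        rw [ih i hlt ?_, zero_mul]
        rw [show (i : ℤ) + a = d + a - j by rw [← hij]; push_cast; ring]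
        exact dvd_sub hd hj
      · rw [hc j hj, mul_zero]
    · intro h2
      simp at h2

lemma coeff_mul_altSign_mul_mono (P : ℤ⟦X⟧) (j : ℤ) {e : ℤ} (he : 0 ≤ e) (d : ℕ) :
    coeff d (P * (altSign j * mono e)) =
      if 0 ≤ d - e then (-1) ^ j.natAbs * coeff (d - e).toNat P else 0 := by
  have h : P * (altSign j * mono e) = C ((-1 : ℤ) ^ j.natAbs) * (P * X ^ e.toNat) := by
    rw [altSign, mono, map_pow, map_neg, map_one]
    ring
  rw [h, coeff_C_mul, coeff_mul_X_pow']
  by_cases hd : 0 ≤ d - e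
  · rw [if_pos (by omega), if_pos hd, show (d - e).toNat = d - e.toNat by omega]
  · rw [if_neg (by omega), if_neg hd, mul_zero]

end ThetaQuotient

open ThetaQuotient

/-- Let `k > 1`, `m > 1`, `0 ≤ s < k`, `1 ≤ t < m`, `r = sm + t` with `gcd(r, k) = 1`.
Then for every integer `n`,
`∑_j (-1)^j p_{m,k,r}(nk - rs - mk·j(j+1)/2 - j(tk - r)) = 0`,
the (finitely supported) sum running over all integers `j` for which the argument is
nonnegative. -/
theorem partition_alternating_sum_vanishes (k m s t : ℕ) (hk : 1 < k) (hm : 1 < m)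
    (hs : s < k) (ht1 : 1 ≤ t) (ht2 : t < m)
    (r : ℕ) (hr : r = s * m + t) (hgcd : Nat.gcd r k = 1) :
    ∀ n : ℤ,
      (∑ᶠ j : ℤ,
        if 0 ≤ n * k - (r : ℤ) * s - (m : ℤ) * k * (j * (j + 1)) / 2 - j * ((t : ℤ) * k - r)
        then ((-1 : ℤ) ^ j.natAbs) *
          (partitionCount m k r
            (n * k - (r : ℤ) * s - (m : ℤ) * k * (j * (j + 1)) / 2
              - j * ((t : ℤ) * k - r)).toNat : ℤ)
        else 0) = 0 := by
  intro n
  have hr0 : 0 < r := by omega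
  have hrM : r < m * k := by nlinarith
  have h2r : 2 * r ≠ m * k := by
    intro h
    have h1 : k ∣ 2 := (Nat.Coprime.symm hgcd).dvd_of_dvd_mul_right ⟨m, by rw [h, mul_comm]⟩
    obtain rfl : k = 2 := by
      have := Nat.le_of_dvd two_pos h1
      omega
    have h3 : s * m + t = m := by omega
    rcases Nat.eq_zero_or_pos s with rfl | hs0
    · omega
    · nlinarith
  have hcop : IsCoprime ((s : ℤ) * m + t) k := by
    have := Nat.isCoprime_iff_coprime.2 hgcd
    rw [hr] at this
    exact_mod_cast this
  have hrZ : (r : ℤ) = s * m + t := by exact_mod_cast hr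
  obtain ⟨M, hM⟩ : ∃ M : ℤ, M = m * k := ⟨_, rfl⟩
  obtain ⟨u, hu⟩ : ∃ u : ℤ, u = (m - t) * k := ⟨_, rfl⟩
  have hr0' : (0 : ℤ) < r := by exact_mod_cast hr0
  have hrM' : (r : ℤ) < M := by rw [hM]; exact_mod_cast hrM
  have hkZ : (1 : ℤ) < k := by exact_mod_cast hk
  have ht1Z : (1 : ℤ) ≤ t := by exact_mod_cast ht1
  have ht2Z : (t : ℤ) < m := by exact_mod_cast ht2
  have hu0 : 0 < u := by rw [hu]; nlinarith
  have huM : u < M := by rw [hu, hM]; nlinarith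
  have hkM : (k : ℤ) ∣ M := hM ▸ dvd_mul_left _ _
  have hku : (k : ℤ) ∣ u := hu ▸ dvd_mul_left _ _
  set P : ℤ⟦X⟧ := PowerSeries.mk fun N ↦ (partitionCount m k r N : ℤ) with hP
  have hPθ : P * theta M r = 1 := by
    have := mk_partitionCount_mul_theta hr0 hrM h2r
    rwa [Nat.cast_mul, ← hM] at this
  have hF : P * shiftedTheta M r u * appell M u 0 = lambert M r u := by
    have h := theta_mul_lambert hr0' hrM' hu0 huM
    linear_combination lambert M r u * hPθ - P * h
  have hzero := coeff_eq_zero_of_mul_eq hF (constantCoeff_appell hu0 huM)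
    (a := r * (s + 1)) (fun d hd ↦ coeff_appell_eq_zero hu0 huM hkM hku hd) (fun d hd ↦ by
      rw [hM, hu, hrZ]
      rw [hrZ] at hd
      exact coeff_lambert_eq_zero (by omega) (by omega) (by omega) ht1Z ht2Z hcop hd)
  obtain ⟨D, hD⟩ : ∃ D : ℤ, D = n * k - r * s - r + t * k + M := ⟨_, rfl⟩
  have hE (N : ℤ) : n * k - (r : ℤ) * s - (m : ℤ) * k * ((-1 - N) * (-1 - N + 1)) / 2 -
      (-1 - N) * ((t : ℤ) * k - r) = D - (M + r * N + thetaExp M u N) := by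
    have h1 : (m : ℤ) * k * ((-1 - N) * (-1 - N + 1)) = 2 * (M * (tri N + N)) := by
      linear_combination -(m * k : ℤ) * two_mul_tri N - 2 * (tri N + N) * hM
    rw [h1, Int.mul_ediv_cancel_left _ two_ne_zero, thetaExp, hD, hu]
    linear_combination -N * hM
  have hnonneg (N : ℤ) := (abs_nonneg N).trans (abs_le_add_thetaExp hr0' hrM' hu0 huM N)
  rw [← finsum_comp_equiv (Equiv.subLeft (-1 : ℤ))]
  simp only [Equiv.subLeft_apply, hE]
  rcases lt_or_ge D 0 with hD0 | hD0
  · convert finsum_zero with N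
    rw [if_neg (by linarith [hnonneg N])]
  obtain ⟨d, rfl⟩ := Int.eq_ofNat_of_zero_le hD0
  have hd : (k : ℤ) ∣ d + r * (s + 1) := by
    rw [hD, show n * k - r * s - r + t * k + M + r * (s + 1) = (n + t + m) * (k : ℤ) by
      rw [hM]; ring]
    exact dvd_mul_left _ _
  have hcoeff := hzero d hd
  have hnull := xAdicNull_shiftedTheta hr0' hrM' hu0 huM
  rw [shiftedTheta, ← hnull.summable.tsum_mul_left, (hnull.mul_left P).coeff_tsum] at hcoeff
  rw [← neg_eq_zero, ← finsum_neg_distrib]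
  refine (finsum_congr fun N ↦ ?_).trans hcoeff
  have hsgn : (-1 : ℤ) ^ (-1 - N).natAbs = -(-1) ^ N.natAbs := by
    rw [show -1 - N = -(N + 1) by ring, Int.natAbs_neg]
    rcases Int.even_or_odd N with h | h
    · rw [(Int.natAbs_even.2 h).neg_one_pow, (Int.natAbs_odd.2 h.add_one).neg_one_pow]
    · rw [(Int.natAbs_odd.2 h).neg_one_pow, (Int.natAbs_even.2 h.add_one).neg_one_pow, neg_neg]
  rw [coeff_mul_altSign_mul_mono P N (hnonneg N), hsgn, hP, coeff_mk]
  split_ifs <;> ring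
end

section
/- Let k > 1 and m > 1 be integers with k odd, and let s, t be integers with 0 ≤ s < k and 1 ≤ t < m. Set r = sm + t, and assume gcd(r, k) = 1 and r − tk > 0. For an integer N ≥ 0, let p^e_{m,k,s,t}(N) (respectively p^o_{m,k,s,t}(N)) denote the number of partitions of N into parts (possibly repeated) congruent to ±r modulo mk together with distinct parts congruent to ±(r − tk) modulo mk, in which the total number of parts, counted with multiplicity, is even (respectively odd). Then for every integer n with nk − rs ≥ 0, p^e_{m,k,s,t}(nk − rs) = p^o_{m,k,s,t}(nk − rs). -/
/-- The multiset `P` of parts satisfies: every part is congruent to `±r` or `±b`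
modulo `m * k`, and every part congruent to `±b` modulo `m * k` occurs at most once
(parts congruent to `±r` may repeat). -/
def AdmissibleParts (m k r b : ℕ) (P : Multiset ℕ) : Prop :=
  (∀ x ∈ P, (x : ZMod (m * k)) = (r : ZMod (m * k)) ∨
      (x : ZMod (m * k)) = -(r : ZMod (m * k)) ∨
      (x : ZMod (m * k)) = (b : ZMod (m * k)) ∨
      (x : ZMod (m * k)) = -(b : ZMod (m * k))) ∧
  (∀ x ∈ P, ((x : ZMod (m * k)) = (b : ZMod (m * k)) ∨
      (x : ZMod (m * k)) = -(b : ZMod (m * k))) → P.count x ≤ 1)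

/-- The number of partitions of `N` into parts (possibly repeated) congruent to `±r`
modulo `m * k` together with distinct parts congruent to `±b` modulo `m * k`, in which
the total number of parts, counted with multiplicity, is even. -/
noncomputable def evenPartitionCount (m k r b N : ℕ) : ℕ :=
  Nat.card {p : N.Partition // AdmissibleParts m k r b p.parts ∧ Even (Multiset.card p.parts)}

/-- As `evenPartitionCount`, but with an odd total number of parts. -/
noncomputable def oddPartitionCount (m k r b N : ℕ) : ℕ :=
  Nat.card {p : N.Partition // AdmissibleParts m k r b p.parts ∧ Odd (Multiset.card p.parts)}

open Finset

/-- The finite `q`-Pochhammer product `(z; Q)_n = ∏_{i < n} (1 - z Q ^ i)`. -/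
def qPoch {R : Type*} [CommRing R] (z Q : R) (n : ℕ) : R :=
  ∏ i ∈ range n, (1 - z * Q ^ i)

section Field

variable {K : Type*} [Field K]

open Polynomial in
/-- Partial fractions of `∏ (1 - x z u i) / ∏ (1 - z u i)` in the variable `z`. -/
theorem prod_one_sub_div_prod_one_sub {ι : Type*} [DecidableEq ι] (s : Finset ι) (u : ι → K)
    (hu : Set.InjOn u s) (hu0 : ∀ i ∈ s, u i ≠ 0) (x z : K) (hz : ∀ i ∈ s, 1 - z * u i ≠ 0) :
    (∏ i ∈ s, (1 - x * z * u i)) / ∏ i ∈ s, (1 - z * u i) =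
      x ^ s.card + ∑ n ∈ s, (∏ i ∈ s, (1 - x * (u i / u n))) /
        (∏ j ∈ s.erase n, (1 - u j / u n)) / (1 - z * u n) := by
  set p : K[X] := ∏ i ∈ s, (1 - C (x * u i) * X) - C (x ^ s.card) * ∏ i ∈ s, (1 - C (u i) * X)
    with hp
  have hcoef (c : ι → K) :
      (∏ i ∈ s, (1 - C (c i) * X)).natDegree ≤ s.card ∧
        (∏ i ∈ s, (1 - C (c i) * X)).coeff s.card = ∏ i ∈ s, (- c i) := by
    have hd (i : ι) : (1 - C (c i) * X).natDegree ≤ 1 := by compute_degree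
    constructor
    · refine (natDegree_prod_le _ _).trans ((sum_le_sum fun i _ => hd i).trans ?_)
      simp
    · have := coeff_prod_of_natDegree_le s (fun i => 1 - C (c i) * X) 1 (fun i _ => hd i)
      rw [mul_one] at this
      rw [this]
      refine prod_congr rfl fun i _ => ?_
      simp [coeff_one]
  have hdeg : p.degree < s.card := by
    rw [degree_lt_iff_coeff_zero]
    intro m hm
    rcases hm.eq_or_lt with rfl | hm
    · rw [hp, coeff_sub, coeff_C_mul, (hcoef _).2, (hcoef _).2, ← prod_const, ← prod_mul_distrib,
        sub_eq_zero]
      exact prod_congr rfl fun i _ => by ring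
    · rw [hp, coeff_sub, coeff_C_mul, coeff_eq_zero_of_natDegree_lt ((hcoef _).1.trans_lt hm),
        coeff_eq_zero_of_natDegree_lt ((hcoef _).1.trans_lt hm)]
      simp
  have hinj : Set.InjOn (fun i => (u i)⁻¹) s := fun i hi j hj h => hu hi hj (inv_injective h)
  have key := congrArg (eval z) (Lagrange.eq_interpolate hinj hdeg)
  rw [Lagrange.interpolate_apply, eval_finsetSum] at key
  have hP : ∏ i ∈ s, (1 - z * u i) ≠ 0 := prod_ne_zero_iff.2 hz
  rw [div_eq_iff hP, add_mul, ← sub_eq_iff_eq_add']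
  have hL : eval z p = ∏ i ∈ s, (1 - x * z * u i) - x ^ s.card * ∏ i ∈ s, (1 - z * u i) := by
    simp only [hp, eval_sub, eval_mul, eval_prod, eval_C, eval_one, eval_X]
    congr 1
    · exact prod_congr rfl fun i _ => by ring
    · congr 1
      exact prod_congr rfl fun i _ => by ring
  rw [← hL, key, sum_mul]
  refine sum_congr rfl fun n hn => ?_
  have hun := hu0 n hn
  have hval : eval (u n)⁻¹ p = ∏ i ∈ s, (1 - x * (u i / u n)) := by
    simp only [hp, eval_sub, eval_mul, eval_prod, eval_C, eval_one, eval_X]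
    rw [prod_eq_zero (f := fun i => 1 - u i * (u n)⁻¹) hn (by simp [hun]), mul_zero, sub_zero]
    exact prod_congr rfl fun i _ => by ring
  have hbasis : eval z (Lagrange.basis s (fun i => (u i)⁻¹) n) =
      (∏ j ∈ s.erase n, (1 - z * u j)) / ∏ j ∈ s.erase n, (1 - u j / u n) := by
    rw [Lagrange.basis, eval_prod, ← prod_div_distrib]
    refine prod_congr rfl fun j hj => ?_
    have huj := hu0 j (mem_of_mem_erase hj)
    have hne : u n - u j ≠ 0 := fun h =>
      (ne_of_mem_erase hj) (hu (mem_of_mem_erase hj) hn (sub_eq_zero.1 h).symm)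
    have hne' : u j - u n ≠ 0 := fun h => hne (by linear_combination -h)
    have e : (u n)⁻¹ - (u j)⁻¹ = (u j - u n) / (u n * u j) := by field_simp
    have e2 : 1 - u j / u n = (u n - u j) / u n := by field_simp
    simp only [Lagrange.basisDivisor, eval_mul, eval_C, eval_sub, eval_X, e, e2]
    field_simp
    ring
  rw [eval_mul, eval_C, hval, hbasis, ← mul_prod_erase s (fun i => 1 - z * u i) hn, ← mul_assoc,
    div_mul_cancel₀ _ (hz n hn), div_mul_eq_mul_div, mul_div_assoc]

/-- Reflecting the factors with negative exponent in a bilateral product. -/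
theorem prod_range_add_one_sub_mul_div (z Q : K) (hz : z ≠ 0) (hQ : Q ≠ 0) (a b : ℕ) :
    ∏ i ∈ range (a + b), (1 - z * (Q ^ i / Q ^ a)) =
      (-z) ^ a / (∏ i ∈ range a, Q ^ (i + 1)) * qPoch (Q / z) Q a * qPoch z Q b := by
  rw [prod_range_add]
  congr 1
  · have hpow : (-z) ^ a = ∏ _i ∈ range a, (-z) := by simp
    rw [← prod_range_reflect, qPoch, div_mul_eq_mul_div, hpow, ← prod_mul_distrib,
      ← prod_div_distrib]
    refine prod_congr rfl fun i hi => ?_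
    have h : a = (a - 1 - i) + (i + 1) := by have := mem_range.1 hi; omega
    have h2 : Q ^ a = Q ^ (a - 1 - i) * Q ^ (i + 1) := by rw [← pow_add, ← h]
    rw [h2]
    field_simp
    ring
  · exact prod_congr rfl fun i _ => by rw [pow_add]; field_simp

theorem qPoch_div_qPoch_eq_sum_range (x y Q : K) (N : ℕ) (hx : x ≠ 0) (hy : y ≠ 0) (hQ : Q ≠ 0)
    (hQ1 : ∀ n : ℕ, 1 - Q ^ (n + 1) ≠ 0) (h1 : ∀ n : ℕ, 1 - y * Q ^ n ≠ 0)
    (h2 : ∀ n : ℕ, 1 - Q / y * Q ^ n ≠ 0) :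
    x ^ N * (qPoch (x * y) Q N * qPoch (Q / (x * y)) Q N / (qPoch y Q N * qPoch (Q / y) Q N)) =
      x ^ (N + N) + ∑ n ∈ range (N + N), x ^ n * (qPoch (Q / x) Q n * qPoch x Q (N + N - n) /
        (qPoch Q Q n * qPoch Q Q (N + N - 1 - n))) / (1 - y * (Q ^ n / Q ^ N)) := by
  have hinj : Function.Injective (fun n : ℕ => Q ^ n) := by
    have aux (i j : ℕ) (hij : i < j) : Q ^ i ≠ Q ^ j := by
      intro h
      obtain ⟨d, rfl⟩ := Nat.exists_eq_add_of_lt hij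
      refine hQ1 d ?_
      have : Q ^ i * (1 - Q ^ (d + 1)) = 0 := by rw [mul_sub, ← pow_add, ← add_assoc, ← h]; ring
      exact (mul_eq_zero.1 this).resolve_left (pow_ne_zero _ hQ)
    intro i j h
    rcases lt_trichotomy i j with hij | hij | hij
    · exact absurd h (aux _ _ hij)
    · exact hij
    · exact absurd h.symm (aux _ _ hij)
  have hQN : Q ^ N ≠ 0 := pow_ne_zero _ hQ
  have hden : ∀ i ∈ range (N + N), 1 - y / Q ^ N * Q ^ i ≠ 0 := by
    intro i hi h
    rcases lt_or_ge i N with hiN | hiN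
    · have e : Q ^ N = Q ^ i * Q ^ (N - 1 - i) * Q := by
        rw [← pow_add, ← pow_succ]; congr 1; omega
      refine h2 (N - 1 - i) ?_
      rw [e] at h
      have := pow_ne_zero i hQ
      have := pow_ne_zero (N - 1 - i) hQ
      field_simp at h ⊢
      linear_combination -h
    · refine h1 (i - N) ?_
      have e : Q ^ i = Q ^ N * Q ^ (i - N) := by rw [← pow_add]; congr 1; omega
      rw [e] at h
      rw [← h]
      field_simp
  have key := prod_one_sub_div_prod_one_sub (range (N + N)) (fun n => Q ^ n) hinj.injOn
    (fun i _ => pow_ne_zero _ hQ) x (y / Q ^ N) hden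
  have eL (w : K) : ∏ i ∈ range (N + N), (1 - w / Q ^ N * Q ^ i) =
      ∏ i ∈ range (N + N), (1 - w * (Q ^ i / Q ^ N)) :=
    prod_congr rfl fun i _ => by ring
  rw [← mul_div_assoc, eL, eL, prod_range_add_one_sub_mul_div _ _ (mul_ne_zero hx hy) hQ,
    prod_range_add_one_sub_mul_div _ _ hy hQ, card_range] at key
  have hg (a : ℕ) : ∏ i ∈ range a, Q ^ (i + 1) ≠ 0 :=
    prod_ne_zero_iff.2 fun i _ => pow_ne_zero _ hQ
  have hp (w : K) (hw : ∀ n : ℕ, 1 - w * Q ^ n ≠ 0) (a : ℕ) : qPoch w Q a ≠ 0 :=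
    prod_ne_zero_iff.2 fun i _ => hw i
  have hpQ := hp Q (fun n => by rw [← pow_succ']; exact hQ1 n)
  calc _ = _ := ?_
    _ = _ := key
    _ = _ := ?_
  · have := hg N
    have := hp _ h1 N
    have := hp _ h2 N
    rw [neg_pow (x * y), neg_pow y, mul_pow]
    have : (-1 : K) ^ N ≠ 0 := pow_ne_zero _ (by simp)
    field_simp
  · congr 1
    refine sum_congr rfl fun n hn => ?_
    have hn' := mem_range.1 hn
    congr 1
    · have e1 : N + N = n + (N + N - n) := by omega
      have e2 : N + N = n + 1 + (N + N - 1 - n) := by omega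
      have hr : ∏ j ∈ (range (N + N)).erase n, (1 - Q ^ j / Q ^ n) =
          (-1) ^ n / (∏ i ∈ range n, Q ^ (i + 1)) * qPoch Q Q n * qPoch Q Q (N + N - 1 - n) := by
        have h3 : (range (N + N)).erase n = (range (n + 1 + (N + N - 1 - n))).erase n := by
          rw [← e2]
        have h4 := prod_range_add_one_sub_mul_div (1 : K) Q one_ne_zero hQ n 0
        simp only [add_zero, one_mul, div_one, qPoch, range_zero, prod_empty, mul_one] at h4
        have h5 : (range (n + 1 + (N + N - 1 - n))).erase n =
            (range n).disjUnion ((range (N + N - 1 - n)).map (addLeftEmbedding (n + 1)))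
              (by
                rw [disjoint_left]
                intro a ha hb
                simp only [mem_map, mem_range, addLeftEmbedding_apply] at ha hb
                omega) := by
          ext a
          simp only [mem_erase, mem_range, mem_disjUnion, mem_map, addLeftEmbedding_apply]
          constructor
          · intro h
            by_cases h' : a < n
            · exact Or.inl h'
            · exact Or.inr ⟨a - (n + 1), by omega, by omega⟩
          · rintro (h | ⟨b, hb, rfl⟩) <;> omega
        rw [h3, h5, prod_disjUnion, h4, prod_map]
        congr 1
        refine prod_congr rfl fun i _ => ?_
        have := pow_ne_zero n hQ
        rw [addLeftEmbedding_apply, pow_add, pow_succ]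
        field_simp
      have h6 := prod_range_add_one_sub_mul_div x Q hx hQ n (N + N - n)
      rw [← e1] at h6
      rw [hr, h6, neg_pow x]
      have := hg n
      have := hpQ n
      have := hpQ (N + N - 1 - n)
      have : (-1 : K) ^ n ≠ 0 := pow_ne_zero _ (by simp)
      field_simp
    · ring

/-- A finite form of Kronecker's bilateral partial fraction expansion of a quotient of theta
functions. -/
theorem qPoch_div_qPoch_eq (x y Q : K) (N : ℕ) (hx : x ≠ 0) (hy : y ≠ 0) (hQ : Q ≠ 0)
    (hQ1 : ∀ n : ℕ, 1 - Q ^ (n + 1) ≠ 0) (h1 : ∀ n : ℕ, 1 - y * Q ^ n ≠ 0)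
    (h2 : ∀ n : ℕ, 1 - Q / y * Q ^ n ≠ 0) :
    qPoch (x * y) Q N * qPoch (Q / (x * y)) Q N / (qPoch y Q N * qPoch (Q / y) Q N) =
      x ^ N + ∑ n ∈ range N, x ^ n * (qPoch (Q / x) Q (N + n) * qPoch x Q (N - n) /
          (qPoch Q Q (N + n) * qPoch Q Q (N - 1 - n))) / (1 - y * Q ^ n)
        - Q / (x * y) * ∑ n ∈ range N, (Q / x) ^ n *
          (qPoch (Q / x) Q (N - 1 - n) * qPoch x Q (N + 1 + n) /
            (qPoch Q Q (N - 1 - n) * qPoch Q Q (N + n))) / (1 - Q / y * Q ^ n) := by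
  have hxN : x ^ N ≠ 0 := pow_ne_zero _ hx
  have hQN : Q ^ N ≠ 0 := pow_ne_zero _ hQ
  refine mul_left_cancel₀ hxN ?_
  rw [qPoch_div_qPoch_eq_sum_range x y Q N hx hy hQ hQ1 h1 h2, sum_range_add,
    ← sum_range_reflect (n := N), mul_sub, mul_add, pow_add, add_sub_assoc,
    add_comm (∑ _ ∈ _, _), sub_eq_add_neg, mul_sum, mul_sum, mul_sum, ← sum_neg_distrib]
  congr 2
  · refine sum_congr rfl fun n _ => ?_
    rw [show N + N - (N + n) = N - n by omega, show N + N - 1 - (N + n) = N - 1 - n by omega,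
      pow_add, pow_add Q, mul_div_cancel_left₀ _ hQN]
    ring
  · refine sum_congr rfl fun n hn => ?_
    have hn' := mem_range.1 hn
    rw [show N + N - (N - 1 - n) = N + 1 + n by omega,
      show N + N - 1 - (N - 1 - n) = N + n by omega]
    generalize qPoch (Q / x) Q (N - 1 - n) * qPoch x Q (N + 1 + n) /
            (qPoch Q Q (N - 1 - n) * qPoch Q Q (N + n)) = c
    have e (w : K) : w ^ N = w ^ (N - 1 - n) * w ^ (n + 1) := by
      rw [← pow_add]; congr 1; omega
    have h3 : 1 - y * (Q ^ (N - 1 - n) / Q ^ N) = -(y / Q ^ (n + 1)) * (1 - Q / y * Q ^ n) := by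
      rw [e Q]
      have := pow_ne_zero (N - 1 - n) hQ
      field_simp
      ring
    rw [h3, e x, div_pow]
    have := h2 n
    have h4 := pow_ne_zero n hQ
    have h5 := pow_ne_zero n hx
    rw [pow_succ x, pow_succ Q]
    generalize 1 - Q / y * Q ^ n = D at *
    field_simp

end Field

section PowerSeries

open PowerSeries

theorem map_qPoch {R S : Type*} [CommRing R] [CommRing S] (f : R →+* S) (z Q : R) (n : ℕ) :
    f (qPoch z Q n) = qPoch (f z) (f Q) n := by
  simp [qPoch]

theorem constantCoeff_one_sub_of_X_dvd {R : Type*} [CommRing R] {f : R⟦X⟧} (hf : X ∣ f) :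
    constantCoeff (1 - f) = 1 := by
  simp [X_dvd_iff.1 hf]

theorem constantCoeff_qPoch {R : Type*} [CommRing R] {z : R⟦X⟧} (hz : X ∣ z) (Q : R⟦X⟧) (n : ℕ) :
    constantCoeff (qPoch z Q n) = 1 := by
  rw [qPoch, map_prod]
  exact prod_eq_one fun i _ => constantCoeff_one_sub_of_X_dvd (hz.mul_right _)

variable {F : Type*} [Field F]

theorem map_inv_of_constantCoeff_eq_one {K : Type*} [Field K] (f : F⟦X⟧ →+* K) {a : F⟦X⟧}
    (ha : constantCoeff a = 1) : f a⁻¹ = (f a)⁻¹ := by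
  refine eq_inv_of_mul_eq_one_left ?_
  rw [← map_mul, PowerSeries.inv_mul_cancel _ (by simp [ha]), map_one]

theorem qPoch_mul_inv_eq {x x' y w v Q : F⟦X⟧} (hQ0 : Q ≠ 0) (hx : x * x' = Q) (hy : y * w = Q)
    (hv : x * y * v = Q) (hXy : X ∣ y) (hXw : X ∣ w) (N : ℕ) :
    qPoch (x * y) Q N * qPoch v Q N * (qPoch y Q N * qPoch w Q N)⁻¹ =
      x ^ N + ∑ n ∈ range N, x ^ n * (qPoch x' Q (N + n) * qPoch x Q (N - n) *
          (qPoch Q Q (N + n) * qPoch Q Q (N - 1 - n))⁻¹) * (1 - y * Q ^ n)⁻¹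
        - v * ∑ n ∈ range N, x' ^ n *
          (qPoch x' Q (N - 1 - n) * qPoch x Q (N + 1 + n) *
            (qPoch Q Q (N - 1 - n) * qPoch Q Q (N + n))⁻¹) * (1 - w * Q ^ n)⁻¹ := by
  have hXQ : X ∣ Q := hy ▸ hXy.mul_right w
  let ι := algebraMap F⟦X⟧ (FractionRing F⟦X⟧)
  have hι : Function.Injective ι := IsFractionRing.injective _ _
  have h0 {a : F⟦X⟧} (ha : a ≠ 0) : ι a ≠ 0 := (map_ne_zero_iff ι hι).2 ha
  have hx0 : x ≠ 0 := by rintro rfl; exact hQ0 (by simpa using hx.symm)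
  have hy0 : y ≠ 0 := by rintro rfl; exact hQ0 (by simpa using hy.symm)
  have hc {z : F⟦X⟧} (hz : X ∣ z) : ι (1 - z)⁻¹ = (1 - ι z)⁻¹ := by
    rw [map_inv_of_constantCoeff_eq_one ι (constantCoeff_one_sub_of_X_dvd hz), map_sub, map_one]
  have hne {z : F⟦X⟧} (hz : X ∣ z) : 1 - ι z ≠ 0 := by
    rw [← map_one ι, ← map_sub]
    refine h0 fun h => ?_
    simpa [h] using constantCoeff_one_sub_of_X_dvd hz
  have hpp {z z' : F⟦X⟧} (hz : X ∣ z) (hz' : X ∣ z') (a b : ℕ) :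
      ι (qPoch z Q a * qPoch z' Q b)⁻¹ = (qPoch (ι z) (ι Q) a * qPoch (ι z') (ι Q) b)⁻¹ := by
    rw [map_inv_of_constantCoeff_eq_one, map_mul, map_qPoch, map_qPoch]
    rw [map_mul, constantCoeff_qPoch hz, constantCoeff_qPoch hz', one_mul]
  have ex : ι Q / ι x = ι x' := by
    rw [div_eq_iff (h0 hx0), ← map_mul, mul_comm, hx]
  have ey : ι Q / ι y = ι w := by
    rw [div_eq_iff (h0 hy0), ← map_mul, mul_comm, hy]
  have ev : ι Q / (ι x * ι y) = ι v := by
    rw [div_eq_iff (mul_ne_zero (h0 hx0) (h0 hy0)), ← map_mul, ← map_mul, mul_comm, hv]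
  have key := qPoch_div_qPoch_eq (ι x) (ι y) (ι Q) N (h0 hx0) (h0 hy0) (h0 hQ0)
    (fun n => by rw [← map_pow]; exact hne (dvd_pow hXQ n.succ_ne_zero))
    (fun n => by rw [← map_pow, ← map_mul]; exact hne (hXy.mul_right _))
    (fun n => by rw [ey, ← map_pow, ← map_mul]; exact hne (hXw.mul_right _))
  rw [ex, ey, ev] at key
  refine hι ?_
  simp only [map_add, map_sub, map_mul, map_sum, map_pow, map_qPoch, hpp hXy hXw, hpp hXQ hXQ,
    hc (hXy.mul_right _), hc (hXw.mul_right _)]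
  simpa only [div_eq_mul_inv] using key

/-- Reduction of power series modulo `X ^ B`. -/
noncomputable abbrev modXPow (F : Type*) [Field F] (B : ℕ) :
    F⟦X⟧ →+* F⟦X⟧ ⧸ Ideal.span {(X : F⟦X⟧) ^ B} :=
  Ideal.Quotient.mk _

variable {B : ℕ}

theorem modXPow_eq_iff {f g : F⟦X⟧} :
    modXPow F B f = modXPow F B g ↔ ∀ d < B, coeff d f = coeff d g := by
  rw [Ideal.Quotient.mk_eq_mk_iff_sub_mem, Ideal.mem_span_singleton, X_pow_dvd_iff]
  simp [sub_eq_zero]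

theorem modXPow_pow_eq_zero {f : F⟦X⟧} (hf : X ∣ f) {n : ℕ} (hn : B ≤ n) :
    modXPow F B f ^ n = 0 := by
  rw [← map_pow, Ideal.Quotient.eq_zero_iff_mem, Ideal.mem_span_singleton]
  exact (pow_dvd_pow _ hn).trans (pow_dvd_pow_of_dvd hf n)

theorem modXPow_inv_congr {f g : F⟦X⟧} (hf : constantCoeff f = 1) (hg : constantCoeff g = 1)
    (h : modXPow F B f = modXPow F B g) : modXPow F B f⁻¹ = modXPow F B g⁻¹ := by
  have h1 : modXPow F B f * modXPow F B f⁻¹ = 1 := by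
    rw [← map_mul, PowerSeries.mul_inv_cancel _ (by simp [hf]), map_one]
  have h2 : modXPow F B g⁻¹ * modXPow F B g = 1 := by
    rw [← map_mul, PowerSeries.inv_mul_cancel _ (by simp [hg]), map_one]
  rw [h] at h1
  exact (left_inv_eq_right_inv h2 h1).symm

theorem modXPow_qPoch {z Q : F⟦X⟧} (hQ : X ∣ Q) {n : ℕ} (hn : B ≤ n) :
    modXPow F B (qPoch z Q n) = modXPow F B (qPoch z Q B) := by
  obtain ⟨d, rfl⟩ := Nat.exists_eq_add_of_le hn
  rw [qPoch, prod_range_add, map_mul, ← qPoch, map_prod]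
  rw [prod_eq_one, mul_one]
  intro i _
  rw [map_sub, map_mul, map_pow, modXPow_pow_eq_zero hQ (by omega), mul_zero, sub_zero, map_one]

theorem modXPow_one_sub_inv {z : F⟦X⟧} (hz : X ∣ z) {n : ℕ} (hn : B ≤ n) :
    modXPow F B (1 - z)⁻¹ = modXPow F B (∑ j ∈ range n, z ^ j) := by
  have h1 : modXPow F B (1 - z)⁻¹ * modXPow F B (1 - z) = 1 := by
    rw [← map_mul, PowerSeries.inv_mul_cancel, map_one]
    simp [constantCoeff_one_sub_of_X_dvd hz]
  refine left_inv_eq_right_inv h1 ?_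
  rw [← map_mul, mul_neg_geom_sum, map_sub, map_pow, modXPow_pow_eq_zero hz hn, map_one, sub_zero]

/-- Kronecker's expansion of a quotient of theta functions, modulo a power of `X`. -/
theorem modXPow_qPoch_mul_inv_eq {x x' y w v Q : F⟦X⟧} (hQ0 : Q ≠ 0) (hx : x * x' = Q)
    (hy : y * w = Q) (hv : x * y * v = Q) (hXx : X ∣ x) (hXx' : X ∣ x') (hXy : X ∣ y)
    (hXw : X ∣ w) {N : ℕ} (hN : 2 * B ≤ N) :
    modXPow F B (qPoch (x * y) Q B * qPoch v Q B * (qPoch y Q B * qPoch w Q B)⁻¹) =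
      modXPow F B (qPoch x' Q B * qPoch x Q B * (qPoch Q Q B * qPoch Q Q B)⁻¹ *
        (∑ n ∈ range N, ∑ j ∈ range N, x ^ n * (y * Q ^ n) ^ j -
          v * ∑ n ∈ range N, ∑ j ∈ range N, x' ^ n * (w * Q ^ n) ^ j)) := by
  have hXQ : X ∣ Q := hy ▸ hXy.mul_right w
  have hpp {z z' : F⟦X⟧} (hz : X ∣ z) (hz' : X ∣ z') {a b : ℕ} (ha : B ≤ a) (hb : B ≤ b) :
      modXPow F B (qPoch z Q a * qPoch z' Q b)⁻¹ =
        modXPow F B (qPoch z Q B * qPoch z' Q B)⁻¹ := by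
    refine modXPow_inv_congr ?_ ?_ ?_
    · rw [map_mul, constantCoeff_qPoch hz, constantCoeff_qPoch hz', one_mul]
    · rw [map_mul, constantCoeff_qPoch hz, constantCoeff_qPoch hz', one_mul]
    · rw [map_mul, map_mul, modXPow_qPoch hXQ ha, modXPow_qPoch hXQ hb]
  have hNB : B ≤ N := by omega
  have key := congrArg (modXPow F B) (qPoch_mul_inv_eq hQ0 hx hy hv hXy hXw N)
  rw [map_mul, map_mul, hpp hXy hXw hNB hNB, modXPow_qPoch hXQ hNB, modXPow_qPoch hXQ hNB,
    ← map_mul, ← map_mul] at key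
  rw [key, map_sub, map_add, map_pow, modXPow_pow_eq_zero hXx hNB, zero_add, map_mul _ v, map_sum,
    map_sum, map_mul, map_sub, map_mul _ v, map_sum, map_sum, mul_sub, mul_left_comm, mul_sum,
    mul_sum]
  congr 1
  · refine sum_congr rfl fun n hn => ?_
    have hn' := mem_range.1 hn
    rw [← mul_sum, map_mul, map_mul, map_mul _ (x ^ n), ← modXPow_one_sub_inv (hXy.mul_right _) hNB]
    rcases le_or_gt B n with hBn | hBn
    · simp only [map_pow, modXPow_pow_eq_zero hXx hBn, zero_mul, mul_zero]
    · rw [map_mul, map_mul, modXPow_qPoch hXQ (by omega : B ≤ N + n),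
        modXPow_qPoch hXQ (by omega : B ≤ N - n), hpp hXQ hXQ (by omega) (by omega), map_mul,
        map_mul]
      ring
  · rw [← mul_sum]
    congr 1
    rw [mul_sum]
    refine sum_congr rfl fun n hn => ?_
    have hn' := mem_range.1 hn
    rw [← mul_sum, map_mul, map_mul, map_mul _ (x' ^ n), ← modXPow_one_sub_inv (hXw.mul_right _) hNB]
    rcases le_or_gt B n with hBn | hBn
    · simp only [map_pow, modXPow_pow_eq_zero hXx' hBn, zero_mul, mul_zero]
    · rw [map_mul, map_mul, modXPow_qPoch hXQ (by omega : B ≤ N - 1 - n),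
        modXPow_qPoch hXQ (by omega : B ≤ N + 1 + n), hpp hXQ hXQ (by omega) (by omega), map_mul,
        map_mul]
      ring

end PowerSeries

section Vanishing

open PowerSeries

variable {F : Type*} [Field F]

theorem expand_inv_of_constantCoeff_eq_one {k : ℕ} (hk : k ≠ 0) {f : F⟦X⟧}
    (hf : constantCoeff f = 1) : expand k hk f⁻¹ = (expand k hk f)⁻¹ := by
  rw [PowerSeries.eq_inv_iff_mul_eq_one (by simp [hf]), ← map_mul,
    PowerSeries.inv_mul_cancel _ (by simp [hf]), map_one]

theorem coeff_expand_mul_eq_zero {k : ℕ} (hk : k ≠ 0) (g f : F⟦X⟧) (a c : ℕ) (hc : k ∣ c + a)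
    (hf : ∀ d ≤ c, k ∣ d + a → coeff d f = 0) : coeff c (expand k hk g * f) = 0 := by
  rw [coeff_mul]
  refine sum_eq_zero fun p hp => ?_
  rw [HasAntidiagonal.mem_antidiagonal] at hp
  by_cases h : k ∣ p.1
  · rw [hf p.2 (by omega), mul_zero]
    rw [← hp, add_assoc] at hc
    exact (Nat.dvd_add_right h).1 hc
  · rw [coeff_expand_of_not_dvd k hk _ h, zero_mul]

/-- The involution behind the vanishing of the double series: the index pairs of the two double
series with exponents in the residue class of `-r s` modulo `k` are in bijection. -/
theorem coeff_double_sum_eq_zero {k m s t t' r d b : ℕ} (hkodd : Odd k) (hs : s < k)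
    (ht : 0 < t) (ht' : 0 < t') (hm : m = t + t') (hr : r = s * m + t) (hr0 : 0 < r) (hd0 : 0 < d)
    (hgcd : Nat.gcd r k = 1) (hd : d + r = m * k) (hb : b + t * k = r) {c N : ℕ} (hcN : c < N)
    (hc : k ∣ c + r * s) :
    coeff c (∑ n ∈ range N, ∑ j ∈ range N,
        (-X ^ (t * k) : F⟦X⟧) ^ n * (-X ^ d * (X ^ (m * k)) ^ n) ^ j -
      X ^ b * ∑ n ∈ range N, ∑ j ∈ range N,
        (-X ^ (t' * k) : F⟦X⟧) ^ n * (-X ^ r * (X ^ (m * k)) ^ n) ^ j) = 0 := by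
  have hterm (α β γ n j : ℕ) : (-X ^ α : F⟦X⟧) ^ n * (-X ^ β * (X ^ γ) ^ n) ^ j =
      (-1 : F⟦X⟧) ^ (n + j) * X ^ (α * n + β * j + γ * n * j) := by
    rw [neg_pow, mul_pow, neg_pow (X ^ β)]
    ring
  have hcoeff (α e : ℕ) : coeff c ((-1 : F⟦X⟧) ^ α * X ^ e) = if c = e then (-1) ^ α else 0 := by
    have : (-1 : F⟦X⟧) ^ α = C ((-1 : F) ^ α) := by simp
    rw [this, coeff_C_mul, coeff_X_pow, mul_ite, mul_one, mul_zero]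
  have hk0 : 0 < k := by omega
  have hkc : IsCoprime (k : ℤ) (r : ℤ) := by
    rw [Nat.isCoprime_iff_coprime, Nat.coprime_comm]; exact hgcd
  have hdz : (d : ℤ) = m * k - r := by rw [eq_sub_iff_add_eq]; exact_mod_cast hd
  have hbz : (b : ℤ) = r - t * k := by rw [eq_sub_iff_add_eq]; exact_mod_cast hb
  obtain ⟨e, he⟩ := hc
  have hez : (c : ℤ) = k * e - r * s := by rw [eq_sub_iff_add_eq]; exact_mod_cast he
  have hfst {n j : ℕ} (h : c = t * k * n + d * j + m * k * n * j) : j = s + k * (j / k) := by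
    have hz : (c : ℤ) = t * k * n + d * j + m * k * n * j := by exact_mod_cast h
    have hdvd : (k : ℤ) ∣ r * (j - s) :=
      ⟨t * n + m * j + m * n * j - e, by rw [hez, hdz] at hz; linear_combination hz⟩
    have h1 : (s : ℤ) ≡ j [ZMOD k] := Int.modEq_iff_dvd.2 (hkc.dvd_of_dvd_mul_left hdvd)
    have h2 : s % k = j % k := (Int.natCast_modEq_iff.1 h1)
    rw [Nat.mod_eq_of_lt hs] at h2
    rw [h2, Nat.mod_add_div]
  have hsnd {p i : ℕ} (h : c = b + (t' * k * p + r * i + m * k * p * i)) :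
      i = k - 1 - s + k * (i / k) := by
    have hz : (c : ℤ) = b + (t' * k * p + r * i + m * k * p * i) := by exact_mod_cast h
    have hks : ((k - 1 - s : ℕ) : ℤ) = k - 1 - s := by omega
    have hdvd : (k : ℤ) ∣ r * (i - (k - 1 - s : ℕ)) :=
      ⟨e - r + t - t' * p - m * p * i, by
        rw [hez, hbz] at hz
        rw [hks]
        linear_combination -hz⟩
    have h1 : ((k - 1 - s : ℕ) : ℤ) ≡ i [ZMOD k] :=
      Int.modEq_iff_dvd.2 (hkc.dvd_of_dvd_mul_left hdvd)
    have h2 : (k - 1 - s) % k = i % k := (Int.natCast_modEq_iff.1 h1)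
    rw [Nat.mod_eq_of_lt (by omega)] at h2
    rw [h2, Nat.mod_add_div]
  have hexp (n l : ℕ) : t * k * n + d * (s + k * l) + m * k * n * (s + k * l) =
      b + (t' * k * l + r * (k - 1 - s + k * n) + m * k * l * (k - 1 - s + k * n)) := by
    have hks : ((k - 1 - s : ℕ) : ℤ) = k - 1 - s := by omega
    zify
    rw [hks, hdz, hbz, hr, hm]
    push_cast
    ring
  have hdivk (a n : ℕ) (ha : a < k) : (a + k * n) / k = n := by
    rw [Nat.add_mul_div_left _ _ hk0, Nat.div_eq_of_lt ha, zero_add]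
  rw [map_sub, sub_eq_zero, mul_sum]
  simp only [mul_sum, hterm, mul_left_comm (X ^ b), ← pow_add, map_sum, hcoeff]
  rw [← sum_product', ← sum_product', ← sum_filter, ← sum_filter]
  refine sum_bij' (fun q _ => (q.2 / k, k - 1 - s + k * q.1))
    (fun q _ => (q.2 / k, s + k * q.1)) ?_ ?_ ?_ ?_ ?_
  · rintro ⟨n, j⟩ hq
    simp only [mem_filter, mem_product, mem_range] at hq ⊢
    have h := hfst hq.2
    have h2 := hq.2
    rw [h, hexp] at h2
    generalize j / k = l at *
    refine ⟨⟨?_, ?_⟩, h2⟩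
    · have : l ≤ t' * k * l := Nat.le_mul_of_pos_left _ (by positivity)
      omega
    · have : k - 1 - s + k * n ≤ r * (k - 1 - s + k * n) := Nat.le_mul_of_pos_left _ hr0
      omega
  · rintro ⟨p, i⟩ hq
    simp only [mem_filter, mem_product, mem_range] at hq ⊢
    have h := hsnd hq.2
    have h2 := hq.2
    rw [h, ← hexp] at h2
    generalize i / k = n at *
    refine ⟨⟨?_, ?_⟩, h2⟩
    · have : n ≤ t * k * n := Nat.le_mul_of_pos_left _ (by positivity)
      omega
    · have : s + k * p ≤ d * (s + k * p) := Nat.le_mul_of_pos_left _ hd0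
      omega
  · rintro ⟨n, j⟩ hq
    simp only [mem_filter, mem_product, mem_range] at hq ⊢
    rw [hdivk _ _ (by omega), ← hfst hq.2]
  · rintro ⟨p, i⟩ hq
    simp only [mem_filter, mem_product, mem_range] at hq ⊢
    rw [hdivk _ _ (by omega), ← hsnd hq.2]
  · rintro ⟨n, j⟩ hq
    simp only [mem_filter, mem_product, mem_range] at hq ⊢
    have h := hfst hq.2
    generalize j / k = l at *
    rw [h]
    have hpar : Even (n + (s + k * l)) ↔ Even (l + (k - 1 - s + k * n)) := by
      have hks : Even (k - 1 - s) ↔ Even s := by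
        obtain ⟨a, ha⟩ := hkodd
        have : k - 1 - s + s = 2 * a := by omega
        exact Nat.even_add.1 (this ▸ even_two_mul a)
      simp only [Nat.even_add, Nat.even_mul, Nat.not_even_iff_odd.2 hkodd, false_or, hks]
      tauto
    rcases Nat.even_or_odd (n + (s + k * l)) with h' | h'
    · rw [h'.neg_one_pow, (hpar.1 h').neg_one_pow]
    · have h'' := Nat.not_even_iff_odd.1 (hpar.not.1 (Nat.not_even_iff_odd.2 h'))
      rw [h'.neg_one_pow, h''.neg_one_pow]

end Vanishing

section GeneratingFunction

open PowerSeries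

variable {F : Type*} [Field F] (D E : ℕ → Prop) [DecidablePred D] [DecidablePred E]

/-- The character on partitions into distinct parts from `D` and arbitrary parts from `E`, giving
each part the sign `-1`. -/
def signedWeight (F : Type*) [Field F] (i c : ℕ) : F :=
  if D i then (if c = 1 then -1 else 0) else if E i then (-1) ^ c else 0

/-- The factor contributed by the part `i` to the generating function of `signedWeight`. -/
noncomputable def signedFactor (F : Type*) [Field F] (i : ℕ) : F⟦X⟧ :=
  if D i then 1 - X ^ i else if E i then (1 + X ^ i)⁻¹ else 1

open scoped PowerSeries.WithPiTopology in
theorem one_add_tsum_signedWeight [TopologicalSpace F] [DiscreteTopology F] (i : ℕ) :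
    1 + ∑' j, signedWeight D E F (i + 1) (j + 1) • (X : F⟦X⟧) ^ ((i + 1) * (j + 1)) =
      signedFactor D E F (i + 1) := by
  unfold signedWeight signedFactor
  split_ifs with hD hE
  · rw [tsum_eq_single 0]
    · simp [sub_eq_add_neg]
    · intro j hj
      simp [hj]
  · have h0 : constantCoeff (-X ^ (i + 1) : F⟦X⟧) = 0 := by simp
    rw [PowerSeries.eq_inv_iff_mul_eq_one (by simp)]
    have hsum := WithPiTopology.summable_pow_of_constantCoeff_eq_zero h0
    have h1 := WithPiTopology.tsum_pow_mul_one_sub_of_constantCoeff_eq_zero h0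
    rw [sub_neg_eq_add] at h1
    rw [hsum.tsum_eq_zero_add, pow_zero] at h1
    rw [← h1]
    congr 2
    refine tsum_congr fun j => ?_
    rw [neg_pow (X ^ (i + 1)), ← pow_mul, smul_eq_C_mul]
    simp
  · simp

theorem exists_modXPow_genFun_eq_prod (B : ℕ) :
    ∃ T, ∀ n ≥ T, modXPow F B (Nat.Partition.genFun (signedWeight D E F)) =
      modXPow F B (∏ i ∈ range n, signedFactor D E F (i + 1)) := by
  let _ : TopologicalSpace F := ⊥
  have : DiscreteTopology F := ⟨rfl⟩
  open scoped PowerSeries.WithPiTopology in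
  have h := Nat.Partition.hasProd_genFun (signedWeight D E F)
  simp only [one_add_tsum_signedWeight] at h
  have h2 := (WithPiTopology.tendsto_iff_coeff_tendsto _ _ _ _).1 h.tendsto_prod_nat
  simp only [nhds_discrete, Filter.tendsto_pure] at h2
  have h3 : ∀ᶠ n in Filter.atTop, ∀ d ∈ range B,
      coeff d (∏ i ∈ range n, signedFactor D E F (i + 1)) =
        coeff d (Nat.Partition.genFun (signedWeight D E F)) :=
    (Filter.eventually_all_finset _).2 fun d _ => h2 d
  obtain ⟨T, hT⟩ := Filter.eventually_atTop.1 h3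
  exact ⟨T, fun n hn => modXPow_eq_iff.2 fun d hd => (hT n hn d (mem_range.2 hd)).symm⟩

theorem toFinsupp_prod_signedWeight (P : Multiset ℕ) :
    P.toFinsupp.prod (signedWeight D E F) =
      if (∀ x ∈ P, E x ∨ D x) ∧ (∀ x ∈ P, D x → P.count x ≤ 1) then (-1) ^ P.card else 0 := by
  simp only [Finsupp.prod, Multiset.toFinsupp_support, Multiset.toFinsupp_apply]
  split_ifs with h
  · rw [← Multiset.toFinset_sum_count_eq, ← prod_pow_eq_pow_sum]
    refine prod_congr rfl fun x hx => ?_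
    rw [Multiset.mem_toFinset] at hx
    unfold signedWeight
    split_ifs with hD hc hE
    · rw [hc, pow_one]
    · exact absurd (le_antisymm (h.2 x hx hD) (Multiset.one_le_count_iff_mem.2 hx)) hc
    · rfl
    · exact absurd (h.1 x hx) (by tauto)
  · rw [not_and_or] at h
    push Not at h
    rcases h with ⟨x, hx, hE, hD⟩ | ⟨x, hx, hD, hc⟩
    · exact prod_eq_zero (Multiset.mem_toFinset.2 hx) (by simp [signedWeight, hE, hD])
    · exact prod_eq_zero (Multiset.mem_toFinset.2 hx) (by simp [signedWeight, hD, hc.ne'])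

/-- The coefficients of the generating function are the differences of the numbers of partitions
with an even and with an odd number of parts. -/
theorem coeff_genFun_signedWeight (n : ℕ) (A : Multiset ℕ → Prop)
    (hA : ∀ P, A P ↔ (∀ x ∈ P, E x ∨ D x) ∧ (∀ x ∈ P, D x → P.count x ≤ 1)) :
    coeff n (Nat.Partition.genFun (signedWeight D E F)) =
      (Nat.card {p : n.Partition // A p.parts ∧ Even (Multiset.card p.parts)} : F) -
        Nat.card {p : n.Partition // A p.parts ∧ Odd (Multiset.card p.parts)} := by
  classical
  rw [Nat.Partition.coeff_genFun, Nat.card_eq_fintype_card, Nat.card_eq_fintype_card,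
    Fintype.card_subtype, Fintype.card_subtype, ← sum_boole, ← sum_boole, ← sum_sub_distrib]
  refine sum_congr rfl fun p _ => ?_
  rw [toFinsupp_prod_signedWeight]
  simp only [← hA]
  by_cases h : A p.parts
  · rcases Nat.even_or_odd (Multiset.card p.parts) with h' | h'
    · simp [h, h', h'.neg_one_pow, Nat.not_odd_iff_even.2 h']
    · simp [h, h', h'.neg_one_pow, Nat.not_even_iff_odd.2 h']
  · simp [h]

theorem prod_signedFactor_mul_qPoch {M b b' r d : ℕ} (hb : 0 < b) (hb' : 0 < b') (hr : 0 < r)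
    (hd : 0 < d) (hbb : b + b' = M) (hrd : r + d = M) (h1 : b ≠ b') (h2 : r ≠ d) (h3 : b ≠ r)
    (h4 : b ≠ d) (hD : ∀ n e, 0 < e → e ≤ M → (D (M * n + e) ↔ e = b ∨ e = b'))
    (hE : ∀ n e, 0 < e → e ≤ M → (E (M * n + e) ↔ e = r ∨ e = d)) (n : ℕ) :
    (∏ i ∈ range (M * n), signedFactor D E F (i + 1)) *
        (qPoch (-X ^ d) (X ^ M) n * qPoch (-X ^ r) (X ^ M) n) =
      qPoch (X ^ b') (X ^ M) n * qPoch (X ^ b) (X ^ M) n := by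
  induction n with
  | zero => simp [qPoch]
  | succ n ih =>
    have hblock : ∏ i ∈ range M, signedFactor D E F (M * n + i + 1) =
        (1 - X ^ (M * n + b)) * (1 - X ^ (M * n + b')) * (1 + X ^ (M * n + r))⁻¹ *
          (1 + X ^ (M * n + d))⁻¹ := by
      have hsub : ({b - 1, b' - 1, r - 1, d - 1} : Finset ℕ) ⊆ range M := by
        intro i
        simp only [mem_insert, mem_singleton, mem_range]
        omega
      rw [← prod_subset hsub]
      · rw [prod_insert (by simp only [mem_insert, mem_singleton]; omega),
          prod_insert (by simp only [mem_insert, mem_singleton]; omega),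
          prod_insert (by simp only [mem_singleton]; omega), prod_singleton]
        simp only [add_assoc, Nat.sub_add_cancel hb, Nat.sub_add_cancel hb', Nat.sub_add_cancel hr,
          Nat.sub_add_cancel hd]
        unfold signedFactor
        rw [if_pos ((hD n b hb (by omega)).2 (Or.inl rfl)),
          if_pos ((hD n b' hb' (by omega)).2 (Or.inr rfl)),
          if_neg ((hD n r hr (by omega)).not.2 (by omega)),
          if_pos ((hE n r hr (by omega)).2 (Or.inl rfl)),
          if_neg ((hD n d hd (by omega)).not.2 (by omega)),
          if_pos ((hE n d hd (by omega)).2 (Or.inr rfl)), ← mul_assoc, ← mul_assoc]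
      · intro i hi hi'
        simp only [mem_insert, mem_singleton, mem_range] at hi hi'
        unfold signedFactor
        rw [add_assoc, if_neg ((hD n (i + 1) (by omega) (by omega)).not.2 (by omega)),
          if_neg ((hE n (i + 1) (by omega) (by omega)).not.2 (by omega))]
    have hstep (z : F⟦X⟧) : qPoch z (X ^ M) (n + 1) = qPoch z (X ^ M) n * (1 - z * (X ^ M) ^ n) :=
      prod_range_succ _ _
    have hinv (e : ℕ) (he : 0 < e) :
        (1 + X ^ (M * n + e) : F⟦X⟧)⁻¹ * (1 + X ^ (M * n + e)) = 1 :=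
      PowerSeries.inv_mul_cancel _ (by simp [he.ne'])
    have hX (e : ℕ) : (X : F⟦X⟧) ^ (M * n + e) = X ^ e * (X ^ M) ^ n := by ring
    rw [mul_add, mul_one, prod_range_add, hblock, hstep, hstep, hstep, hstep]
    calc _ = (∏ i ∈ range (M * n), signedFactor D E F (i + 1)) *
          (qPoch (-X ^ d) (X ^ M) n * qPoch (-X ^ r) (X ^ M) n) *
          ((1 - X ^ (M * n + b)) * (1 - X ^ (M * n + b'))) *
          ((1 + X ^ (M * n + r))⁻¹ * (1 + X ^ (M * n + r))) *
          ((1 + X ^ (M * n + d))⁻¹ * (1 + X ^ (M * n + d))) := by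
          rw [hX r, hX d]
          ring
      _ = _ := by
          rw [ih, hinv r hr, hinv d hd, hX, hX]
          ring

end GeneratingFunction

open PowerSeries in
/-- The signed count of partitions vanishes in the residue class of `-r s` modulo `k`. -/
theorem coeff_genFun_signedWeight_eq_zero {F : Type*} [Field F] (D E : ℕ → Prop)
    [DecidablePred D] [DecidablePred E] {k m s t t' r d b b' : ℕ} (hkodd : Odd k) (hs : s < k)
    (ht : 0 < t) (ht' : 0 < t') (hm : m = t + t') (hr : r = s * m + t) (hr0 : 0 < r) (hd0 : 0 < d)
    (hb0 : 0 < b) (hb0' : 0 < b') (hgcd : Nat.gcd r k = 1) (hd : d + r = m * k)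
    (hb : b + t * k = r) (hbb : b + b' = m * k) (h1 : b ≠ b') (h2 : r ≠ d) (h3 : b ≠ r) (h4 : b ≠ d)
    (hD : ∀ n e, 0 < e → e ≤ m * k → (D (m * k * n + e) ↔ e = b ∨ e = b'))
    (hE : ∀ n e, 0 < e → e ≤ m * k → (E (m * k * n + e) ↔ e = r ∨ e = d)) {c : ℕ}
    (hc : k ∣ c + r * s) :
    coeff c (Nat.Partition.genFun (signedWeight D E F)) = 0 := by
  have hk0 : k ≠ 0 := by omega
  have hM : 0 < m * k := by omega
  have hdvd {e : ℕ} (he : e ≠ 0) : (X : F⟦X⟧) ∣ X ^ e := dvd_pow_self _ he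
  have hXQ : (X : F⟦X⟧) ∣ X ^ (m * k) := hdvd hM.ne'
  have hXy : (X : F⟦X⟧) ∣ -X ^ d := (dvd_neg.2 (hdvd hd0.ne'))
  have hXw : (X : F⟦X⟧) ∣ -X ^ r := (dvd_neg.2 (hdvd hr0.ne'))
  have hxy : (-X ^ (t * k) : F⟦X⟧) * -X ^ d = X ^ b' := by
    rw [neg_mul_neg, ← pow_add]
    congr 1
    omega
  obtain ⟨T, hT⟩ := exists_modXPow_genFun_eq_prod (F := F) D E (c + 1)
  have hgen : modXPow F (c + 1) (Nat.Partition.genFun (signedWeight D E F)) =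
      modXPow F (c + 1) (qPoch (X ^ b') (X ^ (m * k)) (c + 1) * qPoch (X ^ b) (X ^ (m * k)) (c + 1) *
        (qPoch (-X ^ d) (X ^ (m * k)) (c + 1) * qPoch (-X ^ r) (X ^ (m * k)) (c + 1))⁻¹) := by
    set n := T + (c + 1)
    have hcc (n : ℕ) : constantCoeff (qPoch (-X ^ d : F⟦X⟧) (X ^ (m * k)) n *
        qPoch (-X ^ r) (X ^ (m * k)) n) = 1 := by
      rw [map_mul, constantCoeff_qPoch hXy, constantCoeff_qPoch hXw, one_mul]
    have hn : c + 1 ≤ n := Nat.le_add_left _ _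
    have hprod := prod_signedFactor_mul_qPoch (F := F) D E hb0 hb0' hr0 hd0 hbb
      (by rw [add_comm, hd]) h1 h2 h3 h4 hD hE n
    rw [← PowerSeries.eq_mul_inv_iff_mul_eq (by simp [hcc])] at hprod
    rw [hT (m * k * n) ((Nat.le_add_right T (c + 1)).trans (Nat.le_mul_of_pos_left _ hM)), hprod,
      map_mul, map_mul, modXPow_qPoch hXQ hn, modXPow_qPoch hXQ hn, map_mul, map_mul]
    congr 1
    refine modXPow_inv_congr (hcc _) (hcc _) ?_
    rw [map_mul, map_mul, modXPow_qPoch hXQ hn, modXPow_qPoch hXQ hn]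
  have hkron := modXPow_qPoch_mul_inv_eq (F := F) (B := c + 1) (N := 2 * (c + 1))
    (x := -X ^ (t * k)) (x' := -X ^ (t' * k)) (y := -X ^ d) (w := -X ^ r) (v := X ^ b)
    (Q := X ^ (m * k)) (pow_ne_zero _ X_ne_zero)
    (by rw [neg_mul_neg, ← pow_add, hm, add_mul]) (by rw [neg_mul_neg, ← pow_add, hd])
    (by rw [hxy, ← pow_add, add_comm, hbb])
    (dvd_neg.2 (hdvd (by positivity))) (dvd_neg.2 (hdvd (by positivity))) hXy hXw le_rfl
  rw [hxy] at hkron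
  rw [modXPow_eq_iff.1 (hgen.trans hkron) c c.lt_succ_self]
  have hexpand : qPoch (-X ^ (t' * k) : F⟦X⟧) (X ^ (m * k)) (c + 1) *
      qPoch (-X ^ (t * k)) (X ^ (m * k)) (c + 1) *
      (qPoch (X ^ (m * k)) (X ^ (m * k)) (c + 1) * qPoch (X ^ (m * k)) (X ^ (m * k)) (c + 1))⁻¹ =
      expand k hk0 (qPoch (-X ^ t') (X ^ m) (c + 1) * qPoch (-X ^ t) (X ^ m) (c + 1) *
        (qPoch (X ^ m) (X ^ m) (c + 1) * qPoch (X ^ m) (X ^ m) (c + 1))⁻¹) := by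
    have hq (z Q : F⟦X⟧) (n : ℕ) :
        expand k hk0 (qPoch z Q n) = qPoch (expand k hk0 z) (expand k hk0 Q) n :=
      map_qPoch (expand k hk0 : F⟦X⟧ →ₐ[F] F⟦X⟧).toRingHom z Q n
    have hX (e : ℕ) : expand k hk0 (X ^ e : F⟦X⟧) = X ^ (e * k) := by
      rw [map_pow, expand_X, ← pow_mul, mul_comm]
    have hm0 : m ≠ 0 := by omega
    rw [map_mul, map_mul, expand_inv_of_constantCoeff_eq_one hk0 (by
      rw [map_mul, constantCoeff_qPoch (hdvd hm0), one_mul])]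
    simp only [map_mul, hq, map_neg, hX]
  rw [hexpand]
  refine coeff_expand_mul_eq_zero hk0 _ _ (r * s) c hc fun d' hd' hdvd' => ?_
  exact coeff_double_sum_eq_zero hkodd hs ht ht' hm hr hr0 hd0 hgcd hd hb (by omega) hdvd'

theorem natCast_zmod_eq_iff {M n e e' : ℕ} (heM : e ≤ M) (he' : 0 < e')
    (heM' : e' < M) : ((M * n + e : ℕ) : ZMod M) = e' ↔ e = e' := by
  rw [ZMod.natCast_eq_natCast_iff', Nat.mul_add_mod, Nat.mod_eq_of_lt heM']
  rcases heM.eq_or_lt with rfl | h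
  · rw [Nat.mod_self]
    omega
  · rw [Nat.mod_eq_of_lt h]

/-- Let `k > 1` be odd, `m > 1`, `0 ≤ s < k`, `1 ≤ t < m`, `r = sm + t` with
`gcd(r, k) = 1` and `r - tk > 0`. Then for every `n` with `nk - rs ≥ 0`, the number of
admissible partitions of `nk - rs` (parts `≡ ±r (mod mk)` possibly repeated, together
with distinct parts `≡ ±(r - tk) (mod mk)`) with an even number of parts equals the
number of such partitions with an odd number of parts. -/
theorem even_eq_odd_partition_count (k m s t : ℕ) (hk : 1 < k) (hkodd : Odd k)
    (hm : 1 < m) (hs : s < k) (ht1 : 1 ≤ t) (ht2 : t < m)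
    (r : ℕ) (hr : r = s * m + t) (hgcd : Nat.gcd r k = 1) (htk : t * k < r) :
    ∀ n : ℕ, r * s ≤ k * n →
      evenPartitionCount m k r (r - t * k) (k * n - r * s) =
        oddPartitionCount m k r (r - t * k) (k * n - r * s) := by
  intro n hn
  classical
  set b := r - t * k with hb_def
  have hb0 : 0 < b := Nat.sub_pos_of_lt htk
  have hb : b + t * k = r := Nat.sub_add_cancel htk.le
  have htk0 : 0 < t * k := by positivity
  have hrM : r < m * k := by
    calc r < s * m + m := by omega
      _ = (s + 1) * m := by ring
      _ ≤ k * m := Nat.mul_le_mul_right m hs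
      _ = m * k := mul_comm _ _
  have hk2 : ¬ k ∣ 2 * r := by
    intro h
    have hk2r : Nat.Coprime k (2 * r) :=
      Nat.Coprime.mul_right (Nat.coprime_two_right.2 hkodd) (Nat.coprime_comm.1 hgcd)
    have := Nat.eq_one_of_dvd_coprimes hk2r dvd_rfl h
    omega
  have hneg {e : ℕ} (he : e < m * k) : -(e : ZMod (m * k)) = ((m * k - e : ℕ) : ZMod (m * k)) := by
    rw [Nat.cast_sub he.le, ZMod.natCast_self, zero_sub]
  have hbM : b < m * k := by omega
  let D : ℕ → Prop := fun x => (x : ZMod (m * k)) = b ∨ (x : ZMod (m * k)) = -(b : ZMod (m * k))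
  let E : ℕ → Prop := fun x => (x : ZMod (m * k)) = r ∨ (x : ZMod (m * k)) = -(r : ZMod (m * k))
  have hcount := coeff_genFun_signedWeight (F := ℚ) D E (k * n - r * s)
    (AdmissibleParts m k r b) (fun P => by simp only [AdmissibleParts, D, E, or_assoc])
  rw [coeff_genFun_signedWeight_eq_zero (F := ℚ) D E (t' := m - t) (d := m * k - r)
    (b' := m * k - b) hkodd hs ht1 (by omega) (by omega) hr (by omega) (by omega) hb0 (by omega)
    hgcd (by omega) hb (by omega) ?_ ?_ (by omega) ?_ ?_ ?_
    ⟨n, Nat.sub_add_cancel hn⟩] at hcount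
  · exact_mod_cast (sub_eq_zero.1 hcount.symm)
  · intro h
    refine hk2 ⟨m + 2 * t, ?_⟩
    rw [mul_add, mul_comm k m, mul_left_comm, mul_comm k]
    omega
  · intro h
    exact hk2 ⟨m, by rw [mul_comm k]; omega⟩
  · intro h
    exact hk2 ⟨m + t, by rw [mul_add, mul_comm k, mul_comm k]; omega⟩
  · intro n e he heM
    simp only [D, hneg hbM]
    rw [natCast_zmod_eq_iff heM hb0 hbM, natCast_zmod_eq_iff heM (by omega) (by omega)]
  · intro n e he heM
    simp only [E, hneg hrM]
    rw [natCast_zmod_eq_iff heM (by omega) hrM,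
      natCast_zmod_eq_iff heM (by omega) (by omega)]
end
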